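/- arXiv:2109.02730 — 7 statements merged into one kernel-verified Lean document; each statement's English description precedes it below -/
import Mathlib

section
/- (Integral version of Karamata's inequality.) Let h : ℝ → ℝ be a continuous convex function, and let s₁, s₂ : [0,1] → ℝ be nondecreasing integrable functions such that ∫₀¹ s₁(p) dp = ∫₀¹ s₂(p) dp and ∫₀ᵗ s₁(p) dp ≥ ∫₀ᵗ s₂(p) dp for all t ∈ [0,1]. Then ∫₀¹ h(s₁(p)) dp ≤ ∫₀¹ h(s₂(p)) dp, provided h ∘ s₁ and h ∘ s₂ are integrable on [0,1]. -/
open MeasureTheory Set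

lemma ConvexOn.add_rightDeriv_mul_sub_le {h : ℝ → ℝ} (hconv : ConvexOn ℝ univ h) (x y : ℝ) :
    h x + derivWithin h (Ioi x) x * (y - x) ≤ h y := by
  have hx : x ∈ interior (univ : Set ℝ) := by simp
  rcases lt_trichotomy x y with hxy | rfl | hyx
  · have := hconv.rightDeriv_le_slope_of_mem_interior hx (mem_univ y) hxy
    rw [slope_def_field, le_div_iff₀ (sub_pos.2 hxy)] at this
    linarith
  · simp
  · have := (hconv.slope_le_leftDeriv_of_mem_interior (mem_univ y) hx hyx).trans
      (hconv.leftDeriv_le_rightDeriv_of_mem_interior hx)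
    rw [slope_def_field, div_le_iff₀ (sub_pos.2 hyx)] at this
    linarith

lemma ConvexOn.monotone_rightDeriv {h : ℝ → ℝ} (hconv : ConvexOn ℝ univ h) :
    Monotone fun x => derivWithin h (Ioi x) x := by
  have := hconv.monotoneOn_rightDeriv
  rwa [interior_univ, monotoneOn_univ] at this

/-- The integral of `d` over a lower subset of `[0,1]` is nonpositive if this holds for all
intervals `[0,t]`. -/
lemma setIntegral_inter_nonpos_of_isLowerSet {d : ℝ → ℝ} {L : Set ℝ} (hL : IsLowerSet L)
    (hd : ∀ t ∈ Icc (0 : ℝ) 1, ∫ p in Icc 0 t, d p ≤ 0) :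
    ∫ p in Icc 0 1 ∩ L, d p ≤ 0 := by
  rcases (Icc (0 : ℝ) 1 ∩ L).eq_empty_or_nonempty with hA | hA
  · simp [hA]
  set t := sSup (Icc (0 : ℝ) 1 ∩ L) with ht
  have hbdd : BddAbove (Icc (0 : ℝ) 1 ∩ L) := ⟨1, fun p hp => hp.1.2⟩
  have hsub : Icc 0 1 ∩ L ⊆ Icc 0 t := fun p hp => ⟨hp.1.1, le_csSup hbdd hp⟩
  have ht1 : t ≤ 1 := csSup_le hA fun p hp => hp.1.2
  have ht0 : 0 ≤ t := by
    obtain ⟨p, hp⟩ := hA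
    exact hp.1.1.trans (le_csSup hbdd hp)
  have hsup : Ico 0 t ⊆ Icc 0 1 ∩ L := fun p hp => by
    obtain ⟨q, hq, hpq⟩ := exists_lt_of_lt_csSup hA hp.2
    exact ⟨⟨hp.1, hp.2.le.trans ht1⟩, hL hpq.le hq.2⟩
  have hae : (Icc 0 1 ∩ L : Set ℝ) =ᵐ[volume] Icc 0 t :=
    hsub.eventuallyLE.antisymm (Ico_ae_eq_Icc.symm.le.trans hsup.eventuallyLE)
  rw [setIntegral_congr_set hae]
  exact hd t ⟨ht0, ht1⟩

/-- Chebyshev-type inequality: a monotone weight integrates nonnegatively against a function of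
mean zero all of whose initial integrals are nonpositive. -/
lemma setIntegral_monotone_mul_nonneg {g d : ℝ → ℝ} (hg : Monotone g)
    (hdint : IntegrableOn d (Icc 0 1)) (hd0 : ∫ p in Icc (0 : ℝ) 1, d p = 0)
    (hd : ∀ t ∈ Icc (0 : ℝ) 1, ∫ p in Icc 0 t, d p ≤ 0) :
    0 ≤ ∫ p in Icc (0 : ℝ) 1, g p * d p := by
  let F : ℝ → ℝ → ℝ := fun p u => {q : ℝ × ℝ | q.2 < g q.1}.indicator (fun q => d q.1) (p, u)
  have hlayer : ∀ p ∈ Icc (0 : ℝ) 1, ∫ u in Ioc (g 0) (g 1), F p u = (g p - g 0) * d p := by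
    intro p hp
    have hF : F p = (Iio (g p)).indicator fun _ => d p := by
      ext u
      simp [F, indicator_apply]
    have hinter : Ioc (g 0) (g 1) ∩ Iio (g p) = Ioo (g 0) (g p) := by
      ext u
      have := hg hp.2
      simp only [mem_inter_iff, mem_Ioc, mem_Iio, mem_Ioo]
      constructor
      · rintro ⟨⟨h1, -⟩, h2⟩
        exact ⟨h1, h2⟩
      · rintro ⟨h1, h2⟩
        exact ⟨⟨h1, h2.le.trans this⟩, h2⟩
    rw [hF, setIntegral_indicator measurableSet_Iio, hinter, setIntegral_const,
      Real.volume_real_Ioo_of_le (hg hp.1), smul_eq_mul]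
  have hmeas : MeasurableSet {q : ℝ × ℝ | q.2 < g q.1} :=
    measurableSet_lt measurable_snd (hg.measurable.comp measurable_fst)
  have hFint : Integrable (Function.uncurry F)
      ((volume.restrict (Icc 0 1)).prod (volume.restrict (Ioc (g 0) (g 1)))) :=
    (hdint.comp_fst _).indicator hmeas
  have hslice : ∀ u, 0 ≤ ∫ p in Icc (0 : ℝ) 1, F p u := by
    intro u
    have hS : MeasurableSet {p | u < g p} := measurableSet_lt measurable_const hg.measurable
    have hF : (fun p => F p u) = {p | u < g p}.indicator d := by
      ext p
      simp [F, indicator_apply]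
    have hL : IsLowerSet {p | u < g p}ᶜ := fun p q hqp hp hq => hp (hq.trans_le (hg hqp))
    have hlow := setIntegral_inter_nonpos_of_isLowerSet hL hd
    have hadd := integral_add_compl hS hdint
    rw [Measure.restrict_restrict hS, Measure.restrict_restrict hS.compl, hd0,
      inter_comm _ (Icc 0 1), inter_comm _ (Icc 0 1)] at hadd
    rw [hF, setIntegral_indicator hS]
    linarith
  have hswap : ∫ p in Icc (0 : ℝ) 1, (g p - g 0) * d p =
      ∫ u in Ioc (g 0) (g 1), ∫ p in Icc (0 : ℝ) 1, F p u := by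
    rw [← integral_integral_swap hFint]
    exact setIntegral_congr_fun measurableSet_Icc fun p hp => (hlayer p hp).symm
  have hlayerint : IntegrableOn (fun p => (g p - g 0) * d p) (Icc 0 1) :=
    hFint.integral_prod_left.congr
      ((ae_restrict_iff' measurableSet_Icc).2 (.of_forall hlayer))
  have hsplit : ∫ p in Icc (0 : ℝ) 1, g p * d p =
      (∫ p in Icc (0 : ℝ) 1, (g p - g 0) * d p) + ∫ p in Icc (0 : ℝ) 1, g 0 * d p := by
    rw [← integral_add hlayerint (hdint.const_mul _)]
    congr 1 with p
    ring
  rw [hsplit, hswap, integral_const_mul, hd0, mul_zero, add_zero]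
  exact integral_nonneg hslice

lemma integrableOn_monotone_mul {g d : ℝ → ℝ} (hg : Monotone g)
    (hdint : IntegrableOn d (Icc 0 1)) : IntegrableOn (fun p => g p * d p) (Icc 0 1) := by
  refine Integrable.bdd_mul (c := max |g 0| |g 1|) hdint hg.measurable.aestronglyMeasurable
    ((ae_restrict_iff' measurableSet_Icc).2 (.of_forall fun p hp => ?_))
  exact abs_le_max_abs_abs (hg hp.1) (hg hp.2)


/-- Integral version of Karamata's inequality: if a continuous convex `h` is
applied to two nondecreasing integrable functions on `[0,1]`, one of which
majorizes the other in the integral sense, the integral of `h` composed with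
the majorizing function is smaller. -/
theorem stmt5 (h s₁ s₂ : ℝ → ℝ)
    (hcont : Continuous h) (hconv : ConvexOn ℝ Set.univ h)
    (hs₁mono : MonotoneOn s₁ (Set.Icc 0 1)) (hs₂mono : MonotoneOn s₂ (Set.Icc 0 1))
    (hs₁int : IntegrableOn s₁ (Set.Icc 0 1)) (hs₂int : IntegrableOn s₂ (Set.Icc 0 1))
    (heq : ∫ p in Set.Icc (0:ℝ) 1, s₁ p = ∫ p in Set.Icc (0:ℝ) 1, s₂ p)
    (hmaj : ∀ t ∈ Set.Icc (0:ℝ) 1, ∫ p in Set.Icc 0 t, s₂ p ≤ ∫ p in Set.Icc 0 t, s₁ p)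
    (hhs₁ : IntegrableOn (fun p => h (s₁ p)) (Set.Icc 0 1))
    (hhs₂ : IntegrableOn (fun p => h (s₂ p)) (Set.Icc 0 1)) :
    ∫ p in Set.Icc (0:ℝ) 1, h (s₁ p) ≤ ∫ p in Set.Icc (0:ℝ) 1, h (s₂ p) := by
  let g : ℝ → ℝ := fun p =>
    derivWithin h (Ioi (s₁ (projIcc 0 1 zero_le_one p))) (s₁ (projIcc 0 1 zero_le_one p))
  have hg : Monotone g := fun p q hpq => hconv.monotone_rightDeriv <|
    hs₁mono (projIcc 0 1 zero_le_one p).2 (projIcc 0 1 zero_le_one q).2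
      (monotone_projIcc zero_le_one hpq)
  have hdint : IntegrableOn (fun p => s₂ p - s₁ p) (Icc 0 1) := hs₂int.sub hs₁int
  have hd0 : ∫ p in Icc (0 : ℝ) 1, (s₂ p - s₁ p) = 0 := by
    rw [integral_sub hs₂int hs₁int, heq, sub_self]
  have hd : ∀ t ∈ Icc (0 : ℝ) 1, ∫ p in Icc 0 t, (s₂ p - s₁ p) ≤ 0 := fun t ht => by
    have hsub : Icc 0 t ⊆ Icc (0 : ℝ) 1 := Icc_subset_Icc_right ht.2
    rw [integral_sub (hs₂int.mono_set hsub) (hs₁int.mono_set hsub)]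
    exact sub_nonpos.2 (hmaj t ht)
  have htangent : ∫ p in Icc (0 : ℝ) 1, g p * (s₂ p - s₁ p) ≤
      ∫ p in Icc (0 : ℝ) 1, (h (s₂ p) - h (s₁ p)) := by
    refine setIntegral_mono_on (integrableOn_monotone_mul hg hdint) (hhs₂.sub hhs₁)
      measurableSet_Icc fun p hp => ?_
    have := hconv.add_rightDeriv_mul_sub_le (s₁ p) (s₂ p)
    simp only [g, projIcc_of_mem zero_le_one hp]
    linarith
  rw [integral_sub hhs₂ hhs₁] at htangent
  linarith [setIntegral_monotone_mul_nonneg hg hdint hd0 hd]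
end

section
/- Let L : [0, 1/3] → ℝ be a concave function and let p̲ ∈ (0, 1/3) satisfy L(p̲) = (1/(1/3 − p̲)) · ∫_{p̲}^{1/3} L(t) dt, that is, L(p̲) equals the average value of L over [p̲, 1/3]. Then L is nondecreasing on the interval [0, p̲]. -/
/-- The secant slope of a concave function on `[x, y]` bounds its growth to the right of `y`. -/
theorem ConcaveOn.le_add_secant_slope_mul {s : Set ℝ} {f : ℝ → ℝ} (hf : ConcaveOn ℝ s f)
    {x y u t : ℝ} (hx : x ∈ s) (ht : t ∈ s) (hxy : x < y) (hyu : y ≤ u) (hut : u < t) :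
    f t ≤ f u + (f y - f x) / (y - x) * (t - u) := by
  have key : (f t - f u) / (t - u) ≤ (f y - f x) / (y - x) := by
    rcases hyu.eq_or_lt with rfl | hyu
    · exact hf.slope_anti_adjacent hx ht hxy hut
    · have hu : u ∈ s := hf.1.ordConnected.out hx ht ⟨(hxy.trans hyu).le, hut.le⟩
      have hy : y ∈ s := hf.1.ordConnected.out hx hu ⟨hxy.le, hyu.le⟩
      exact (hf.slope_anti_adjacent hy ht hyu hut).trans (hf.slope_anti_adjacent hx hu hxy hyu)
  rw [div_le_iff₀ (sub_pos.2 hut)] at key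
  linarith

/-- If `L` is concave on `[0, 1/3]` and `L p₀` equals the average value of `L`
over `[p₀, 1/3]` for some `p₀ ∈ (0, 1/3)`, then `L` is nondecreasing on
`[0, p₀]`. -/
theorem stmt6 (L : ℝ → ℝ) (hL : ConcaveOn ℝ (Set.Icc 0 (1/3)) L)
    (p₀ : ℝ) (hp₀ : p₀ ∈ Set.Ioo (0:ℝ) (1/3))
    (havg : L p₀ = (1 / (1/3 - p₀)) * ∫ t in p₀..(1/3 : ℝ), L t) :
    MonotoneOn L (Set.Icc 0 p₀) := by
  obtain ⟨hp0, hp1⟩ := hp₀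
  intro x hx y hy hxy
  by_contra! hlt
  have hxy' : x < y := hxy.lt_of_ne (by rintro rfl; exact hlt.false)
  have hslope : (L y - L x) / (y - x) < 0 :=
    div_neg_of_neg_of_pos (sub_neg.2 hlt) (sub_pos.2 hxy')
  have hgrowth : ∀ u t, p₀ ≤ u → u < t → t ≤ 1/3 →
      L t ≤ L u + (L y - L x) / (y - x) * (t - u) := fun u t hu hut ht =>
    hL.le_add_secant_slope_mul ⟨hx.1, by linarith [hx.2]⟩ ⟨by linarith, ht⟩ hxy'
      (hy.2.trans hu) hut
  generalize (L y - L x) / (y - x) = m at hslope hgrowth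
  have hanti : AntitoneOn L (Set.uIcc p₀ (1/3)) := by
    rw [Set.uIcc_of_le hp1.le]
    intro u hu t ht hut
    rcases hut.eq_or_lt with rfl | hut
    · exact le_rfl
    · linarith [hgrowth u t hu.1 hut ht.2, mul_neg_of_neg_of_pos hslope (sub_pos.2 hut)]
  have hint : ∫ t in p₀..(1/3 : ℝ), L t ≤ ∫ t in p₀..(1/3 : ℝ), (L p₀ + m * (t - p₀)) := by
    refine intervalIntegral.integral_mono_on hp1.le hanti.intervalIntegrable
      (Continuous.intervalIntegrable (by fun_prop) _ _) fun t ht => ?_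
    rcases ht.1.eq_or_lt with rfl | hpt
    · simp
    · exact hgrowth p₀ t le_rfl hpt ht.2
  have hval : ∫ t in p₀..(1/3 : ℝ), (L p₀ + m * (t - p₀)) =
      L p₀ * (1/3 - p₀) + m * ((1/3 - p₀) ^ 2 / 2) := by
    rw [intervalIntegral.integral_add (by simp)
      (Continuous.intervalIntegrable (by fun_prop) _ _), intervalIntegral.integral_const_mul,
      intervalIntegral.integral_comp_sub_right (fun t => t), integral_id,
      intervalIntegral.integral_const, smul_eq_mul]
    ring
  have hc : 0 < 1/3 - p₀ := sub_pos.2 hp1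
  have havg' : L p₀ * (1/3 - p₀) = ∫ t in p₀..(1/3 : ℝ), L t := by
    rwa [one_div_mul_eq_div, eq_div_iff hc.ne'] at havg
  have hneg : m * ((1/3 - p₀) ^ 2 / 2) < 0 := mul_neg_of_neg_of_pos hslope (by positivity)
  linarith
end

section
/- Let F be a cumulative distribution function on [0,1] that is continuous and strictly increasing, with quantile function I = F⁻¹, and suppose ∫₀¹ |log I(p)| dp < ∞. Let π be a Borel probability measure on [0,1]³ whose three one-dimensional marginals all equal the measure with CDF F. Fix t ∈ [0,1] and set V := ([0, I(t/3)] × [0,1] × [0,1]) ∪ ([0,1] × [0, I(t/3)] × [0,1]) ∪ ([0,1] × [0,1] × [0, I(t/3)]). Then π(V) ≤ t, and for every measurable set U ⊆ [0,1]³ with V ⊆ U and π(U) = t, it holds that ∫_U log(x₁·x₂·z) dπ(x₁,x₂,z) ≤ 3 · ∫₀^{t/3} ( 2·log I(1−2p) + log I(p) ) dp. -/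
open MeasureTheory Set

/-- Bathtub principle: among sets of equal measure, the integral is largest on a set that collects
the points where `f` is above some level `c`. -/
theorem setIntegral_le_setIntegral_of_bathtub {Ω : Type*} [MeasurableSpace Ω] {π : Measure Ω}
    [IsFiniteMeasure π] {f : Ω → ℝ} (hf : Integrable f π) {U W : Set Ω} (hU : MeasurableSet U)
    (hW : MeasurableSet W) (c : ℝ) (hUW : π.real U = π.real W)
    (hle : ∀ᵐ ω ∂π, ω ∈ U → ω ∉ W → f ω ≤ c) (hge : ∀ᵐ ω ∂π, ω ∈ W → ω ∉ U → c ≤ f ω) :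
    ∫ ω in U, f ω ∂π ≤ ∫ ω in W, f ω ∂π := by
  have hg : Integrable (fun ω => f ω - c) π := hf.sub (integrable_const c)
  have key : ∫ ω in U, (f ω - c) ∂π ≤ ∫ ω in W, (f ω - c) ∂π := by
    rw [← integral_indicator hU, ← integral_indicator hW]
    refine integral_mono_ae (hg.indicator hU) (hg.indicator hW) ?_
    filter_upwards [hle, hge] with ω h1 h2
    by_cases hωU : ω ∈ U <;> by_cases hωW : ω ∈ W <;> simp_all
  rw [integral_sub hf.integrableOn (integrable_const c),
    integral_sub hf.integrableOn (integrable_const c)] at key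
  simp only [setIntegral_const, hUW] at key
  linarith

section Quantile

variable {F I : ℝ → ℝ}

theorem quantile_le_iff (hFmono : StrictMonoOn F (Icc 0 1))
    (hQ : ∀ p ∈ Icc (0 : ℝ) 1, I p ∈ Icc (0 : ℝ) 1 ∧ F (I p) = p)
    {p x : ℝ} (hp : p ∈ Icc (0 : ℝ) 1) (hx : x ∈ Icc (0 : ℝ) 1) : I p ≤ x ↔ p ≤ F x := by
  rw [← hFmono.le_iff_le (hQ p hp).1 hx, (hQ p hp).2]

theorem quantile_le_quantile_iff (hFmono : StrictMonoOn F (Icc 0 1))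
    (hQ : ∀ p ∈ Icc (0 : ℝ) 1, I p ∈ Icc (0 : ℝ) 1 ∧ F (I p) = p)
    {p q : ℝ} (hp : p ∈ Icc (0 : ℝ) 1) (hq : q ∈ Icc (0 : ℝ) 1) : I p ≤ I q ↔ p ≤ q := by
  rw [quantile_le_iff hFmono hQ hp (hQ q hq).1, (hQ q hq).2]

theorem aemeasurable_quantile (hFmono : StrictMonoOn F (Icc 0 1))
    (hQ : ∀ p ∈ Icc (0 : ℝ) 1, I p ∈ Icc (0 : ℝ) 1 ∧ F (I p) = p) :
    AEMeasurable I (volume.restrict (Icc 0 1)) :=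
  aemeasurable_restrict_of_monotoneOn measurableSet_Icc
    fun _ hp _ hq hpq => (quantile_le_quantile_iff hFmono hQ hp hq).2 hpq

/-- Inverse transform sampling: the quantile function pushes the uniform measure to the measure
with CDF `F`. -/
theorem map_quantile (hF0 : F 0 = 0) (hF1 : F 1 = 1) (hFmono : StrictMonoOn F (Icc 0 1))
    (hQ : ∀ p ∈ Icc (0 : ℝ) 1, I p ∈ Icc (0 : ℝ) 1 ∧ F (I p) = p)
    (μ : Measure ℝ) [IsProbabilityMeasure μ]
    (hμ : ∀ x ∈ Icc (0 : ℝ) 1, μ (Iic x) = ENNReal.ofReal (F x)) :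
    (volume.restrict (Icc 0 1)).map I = μ := by
  have hI := aemeasurable_quantile hFmono hQ
  have hmem (x : ℝ) (hx : x ∈ Icc (0 : ℝ) 1) : F x ∈ Icc (0 : ℝ) 1 :=
    ⟨hF0 ▸ hFmono.monotoneOn (by simp) hx hx.1, hF1 ▸ hFmono.monotoneOn hx (by simp) hx.2⟩
  refine Measure.ext_of_Iic _ _ fun x => ?_
  rw [Measure.map_apply_of_aemeasurable hI measurableSet_Iic,
    Measure.restrict_apply' measurableSet_Icc]
  rcases lt_or_ge x 0 with hx0 | hx0
  · have h1 : I ⁻¹' Iic x ∩ Icc 0 1 = ∅ := by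
      ext p
      simp only [mem_inter_iff, mem_preimage, mem_Iic, mem_empty_iff_false, iff_false, not_and]
      intro h hp
      linarith [(hQ p hp).1.1]
    have h2 : μ (Iic x) ≤ μ (Iic 0) := measure_mono (Iic_subset_Iic.2 hx0.le)
    rw [hμ 0 (by simp), hF0, ENNReal.ofReal_zero] at h2
    rw [h1, measure_empty, le_antisymm h2 bot_le]
  rcases le_or_gt x 1 with hx1 | hx1
  · have hx : x ∈ Icc (0 : ℝ) 1 := ⟨hx0, hx1⟩
    have h1 : I ⁻¹' Iic x ∩ Icc 0 1 = Icc 0 (F x) := by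
      ext p
      simp only [mem_inter_iff, mem_preimage, mem_Iic]
      constructor
      · rintro ⟨h, hp⟩
        exact ⟨hp.1, (quantile_le_iff hFmono hQ hp hx).1 h⟩
      · intro h
        have hp : p ∈ Icc (0 : ℝ) 1 := ⟨h.1, h.2.trans (hmem x hx).2⟩
        exact ⟨(quantile_le_iff hFmono hQ hp hx).2 h.2, hp⟩
    rw [h1, hμ x hx, Real.volume_Icc, sub_zero]
  · have h1 : I ⁻¹' Iic x ∩ Icc 0 1 = Icc 0 1 := by
      refine inter_eq_right.2 fun p hp => ?_
      exact (hQ p hp).1.2.trans hx1.le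
    have h2 : μ (Iic 1) ≤ μ (Iic x) := measure_mono (Iic_subset_Iic.2 hx1.le)
    rw [hμ 1 (by simp), hF1, ENNReal.ofReal_one] at h2
    rw [h1, le_antisymm prob_le_one h2, Real.volume_Icc]
    simp

theorem integrable_log_comp_quantile (hFmono : StrictMonoOn F (Icc 0 1))
    (hQ : ∀ p ∈ Icc (0 : ℝ) 1, I p ∈ Icc (0 : ℝ) 1 ∧ F (I p) = p)
    (hlogI : IntegrableOn (fun p => |Real.log (I p)|) (Icc 0 1)) :
    Integrable (fun p => Real.log (I p)) (volume.restrict (Icc 0 1)) :=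
  (integrable_norm_iff
    (Real.measurable_log.comp_aemeasurable
      (aemeasurable_quantile hFmono hQ)).aestronglyMeasurable).1 hlogI

/-- Integral of `log` over the lowest `s` and highest `2 s` quantiles. -/
theorem setIntegral_log_tails (hF0 : F 0 = 0) (hF1 : F 1 = 1) (hFmono : StrictMonoOn F (Icc 0 1))
    (hQ : ∀ p ∈ Icc (0 : ℝ) 1, I p ∈ Icc (0 : ℝ) 1 ∧ F (I p) = p)
    (hlogI : IntegrableOn (fun p => |Real.log (I p)|) (Icc 0 1))
    (μ : Measure ℝ) [IsProbabilityMeasure μ]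
    (hμ : ∀ x ∈ Icc (0 : ℝ) 1, μ (Iic x) = ENNReal.ofReal (F x))
    {s : ℝ} (hs0 : 0 ≤ s) (hs : 3 * s ≤ 1) :
    ∫ x in Iic (I s) ∪ Ioi (I (1 - 2 * s)), Real.log x ∂μ
      = ∫ p in (0 : ℝ)..s, (2 * Real.log (I (1 - 2 * p)) + Real.log (I p)) := by
  have hI := aemeasurable_quantile hFmono hQ
  have hg := integrable_log_comp_quantile hFmono hQ hlogI
  have hms : s ∈ Icc (0 : ℝ) 1 := ⟨hs0, by linarith⟩
  have hmr : 1 - 2 * s ∈ Icc (0 : ℝ) 1 := ⟨by linarith, by linarith⟩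
  have hint (a b : ℝ) (ha : a ∈ Icc (0 : ℝ) 1) (hb : b ∈ Icc (0 : ℝ) 1) :
      IntervalIntegrable (fun p => Real.log (I p)) volume a b := by
    refine IntegrableOn.intervalIntegrable ?_
    exact IntegrableOn.mono_set hg (uIcc_subset_Icc ha hb)
  have hset : I ⁻¹' (Iic (I s) ∪ Ioi (I (1 - 2 * s))) ∩ Icc 0 1
      = Icc 0 s ∪ Ioc (1 - 2 * s) 1 := by
    ext p
    simp only [mem_inter_iff, mem_preimage, mem_union, mem_Iic, mem_Ioi, mem_Icc, mem_Ioc]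
    constructor
    · rintro ⟨h, hp⟩
      rw [← not_le, quantile_le_quantile_iff hFmono hQ hp hms,
        quantile_le_quantile_iff hFmono hQ hp hmr] at h
      grind
    · intro h
      have hp : p ∈ Icc (0 : ℝ) 1 := by
        simp only [mem_Icc]
        grind
      rw [← not_le, quantile_le_quantile_iff hFmono hQ hp hms,
        quantile_le_quantile_iff hFmono hQ hp hmr]
      exact ⟨by grind, hp⟩
  have hdisj : Disjoint (Icc 0 s) (Ioc (1 - 2 * s) 1) := by
    rw [Set.disjoint_left]
    rintro p ⟨-, h1⟩ ⟨h2, -⟩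
    linarith
  have hmeas : MeasurableSet (Iic (I s) ∪ Ioi (I (1 - 2 * s))) :=
    measurableSet_Iic.union measurableSet_Ioi
  have hsub : IntervalIntegrable (fun p => Real.log (I (1 - 2 * p))) volume 0 s := by
    have h := ((hint 1 (1 - 2 * s) (by simp) hmr).comp_sub_left 1).comp_mul_left (c := 2)
    convert h using 1 <;> ring
  rw [← map_quantile hF0 hF1 hFmono hQ μ hμ, setIntegral_map hmeas
      Real.measurable_log.aestronglyMeasurable hI, Measure.restrict_restrict₀
      (hI.nullMeasurableSet_preimage hmeas), hset,
    setIntegral_union hdisj measurableSet_Ioc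
      (IntegrableOn.mono_set hg (Icc_subset_Icc le_rfl hms.2))
      (IntegrableOn.mono_set hg (Ioc_subset_Icc_self.trans (Icc_subset_Icc hmr.1 le_rfl))),
    integral_Icc_eq_integral_Ioc, ← intervalIntegral.integral_of_le hs0,
    ← intervalIntegral.integral_of_le hmr.2,
    intervalIntegral.integral_add (hsub.const_mul 2) (hint 0 s (by simp) hms),
    intervalIntegral.integral_const_mul,
    intervalIntegral.integral_comp_sub_mul (fun p => Real.log (I p)) two_ne_zero]
  simp only [mul_zero, sub_zero, smul_eq_mul]
  ring

/-- If `X` has CDF `F` and `U` has mass `3 s` and contains the lowest `s` quantiles of `X`, then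
the integral of `log X` over `U` is at most that over the lowest `s` and highest `2 s` quantiles. -/
theorem setIntegral_log_le (hF0 : F 0 = 0) (hF1 : F 1 = 1) (hFmono : StrictMonoOn F (Icc 0 1))
    (hQ : ∀ p ∈ Icc (0 : ℝ) 1, I p ∈ Icc (0 : ℝ) 1 ∧ F (I p) = p)
    (hlogI : IntegrableOn (fun p => |Real.log (I p)|) (Icc 0 1))
    (μ : Measure ℝ) [IsProbabilityMeasure μ]
    (hμ : ∀ x ∈ Icc (0 : ℝ) 1, μ (Iic x) = ENNReal.ofReal (F x))
    {Ω : Type*} [MeasurableSpace Ω] {π : Measure Ω} [IsProbabilityMeasure π]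
    {X : Ω → ℝ} (hX : Measurable X) (hXμ : π.map X = μ)
    (hXpos : ∀ᵐ ω ∂π, 0 < X ω) (hlogX : Integrable (fun ω => Real.log (X ω)) π)
    {s : ℝ} (hs0 : 0 ≤ s) (hs : 3 * s ≤ 1) {U : Set Ω} (hU : MeasurableSet U)
    (hπU : π U = ENNReal.ofReal (3 * s)) (hlow : ∀ᵐ ω ∂π, X ω ≤ I s → ω ∈ U) :
    ∫ ω in U, Real.log (X ω) ∂π
      ≤ ∫ p in (0 : ℝ)..s, (2 * Real.log (I (1 - 2 * p)) + Real.log (I p)) := by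
  have hms : s ∈ Icc (0 : ℝ) 1 := ⟨hs0, by linarith⟩
  have hmr : 1 - 2 * s ∈ Icc (0 : ℝ) 1 := ⟨by linarith, by linarith⟩
  have hab : I s ≤ I (1 - 2 * s) := (quantile_le_quantile_iff hFmono hQ hms hmr).2 (by linarith)
  have hb : 0 < I (1 - 2 * s) := by
    refine (hQ _ hmr).1.1.lt_of_ne fun h => ?_
    have := (hQ _ hmr).2
    rw [← h, hF0] at this
    linarith
  have hmeas : MeasurableSet (Iic (I s) ∪ Ioi (I (1 - 2 * s))) :=
    measurableSet_Iic.union measurableSet_Ioi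
  have hIic (p : ℝ) (hp : p ∈ Icc (0 : ℝ) 1) : μ.real (Iic (I p)) = p := by
    rw [measureReal_def, hμ _ (hQ p hp).1, (hQ p hp).2, ENNReal.toReal_ofReal hp.1]
  have hmass : π.real (X ⁻¹' (Iic (I s) ∪ Ioi (I (1 - 2 * s)))) = 3 * s := by
    rw [← map_measureReal_apply hX hmeas, hXμ, measureReal_union
      (by
        rw [Set.disjoint_left]
        intro x h1 h2
        exact absurd (hab.trans_lt h2) (not_lt.2 h1)) measurableSet_Ioi,
      hIic s hms, ← compl_Iic, probReal_compl_eq_one_sub measurableSet_Iic, hIic _ hmr]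
    ring
  rw [← setIntegral_log_tails hF0 hF1 hFmono hQ hlogI μ hμ hs0 hs, ← hXμ,
    setIntegral_map hmeas Real.measurable_log.aestronglyMeasurable hX.aemeasurable]
  refine setIntegral_le_setIntegral_of_bathtub hlogX hU (hX hmeas) (Real.log (I (1 - 2 * s)))
    ?_ ?_ ?_
  · rw [hmass, measureReal_def, hπU, ENNReal.toReal_ofReal (by linarith)]
  · filter_upwards [hXpos] with ω hpos _ hω
    simp only [mem_preimage, mem_union, mem_Iic, mem_Ioi, not_or, not_lt] at hω
    exact Real.log_le_log hpos hω.2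
  · filter_upwards [hlow] with ω hl hω hωU
    simp only [mem_preimage, mem_union, mem_Iic, mem_Ioi] at hω
    rcases hω with h | h
    · exact absurd (hl h) hωU
    · exact Real.log_le_log hb h.le

end Quantile

/-- Upper bound on cumulative logarithmic losses: for any coupling `π` on
`[0,1]³` with all three marginals equal to the measure with CDF `F`, the set
`V` of triplets containing a worker, coworker, or firm below the `t/3`
quantile has `π`-measure at most `t`, and for any measurable `U ⊇ V` in
`[0,1]³` with `π U = t`, the integral of `log(x₁·x₂·z)` over `U` is at most
`3·∫₀^{t/3} (2 log I(1−2p) + log I(p)) dp`. -/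
theorem stmt7
    (F I : ℝ → ℝ)
    (hF0 : F 0 = 0) (hF1 : F 1 = 1)
    (hFcont : ContinuousOn F (Set.Icc 0 1))
    (hFmono : StrictMonoOn F (Set.Icc 0 1))
    (hQ : ∀ p ∈ Set.Icc (0:ℝ) 1, I p ∈ Set.Icc (0:ℝ) 1 ∧ F (I p) = p)
    (hlogI : IntegrableOn (fun p => |Real.log (I p)|) (Set.Icc 0 1))
    (μ : Measure ℝ) [IsProbabilityMeasure μ]
    (hμ : ∀ x ∈ Set.Icc (0:ℝ) 1, μ (Set.Iic x) = ENNReal.ofReal (F x))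
    (π : Measure (ℝ × ℝ × ℝ)) [IsProbabilityMeasure π]
    (hπ1 : π.map (fun q => q.1) = μ)
    (hπ2 : π.map (fun q => q.2.1) = μ)
    (hπ3 : π.map (fun q => q.2.2) = μ)
    (t : ℝ) (ht : t ∈ Set.Icc (0:ℝ) 1)
    (V : Set (ℝ × ℝ × ℝ))
    (hV : V = (Set.Icc 0 (I (t/3)) ×ˢ Set.Icc (0:ℝ) 1 ×ˢ Set.Icc (0:ℝ) 1)
        ∪ (Set.Icc (0:ℝ) 1 ×ˢ Set.Icc 0 (I (t/3)) ×ˢ Set.Icc (0:ℝ) 1)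
        ∪ (Set.Icc (0:ℝ) 1 ×ˢ Set.Icc (0:ℝ) 1 ×ˢ Set.Icc 0 (I (t/3)))) :
    π V ≤ ENNReal.ofReal t ∧
    ∀ U : Set (ℝ × ℝ × ℝ), MeasurableSet U →
      U ⊆ Set.Icc (0:ℝ) 1 ×ˢ Set.Icc (0:ℝ) 1 ×ˢ Set.Icc (0:ℝ) 1 →
      V ⊆ U → π U = ENNReal.ofReal t →
      ∫ q in U, Real.log (q.1 * q.2.1 * q.2.2) ∂π
        ≤ 3 * ∫ p in (0:ℝ)..(t/3), (2 * Real.log (I (1 - 2*p)) + Real.log (I p)) := by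
  have hs0 : 0 ≤ t / 3 := by linarith [ht.1]
  have hs : 3 * (t / 3) ≤ 1 := by linarith [ht.2]
  have hms : t / 3 ∈ Icc (0 : ℝ) 1 := ⟨hs0, by linarith⟩
  have hm1 : Measurable (fun q : ℝ × ℝ × ℝ => q.1) := by fun_prop
  have hm2 : Measurable (fun q : ℝ × ℝ × ℝ => q.2.1) := by fun_prop
  have hm3 : Measurable (fun q : ℝ × ℝ × ℝ => q.2.2) := by fun_prop
  have hlow : μ (Iic (I (t / 3))) = ENNReal.ofReal (t / 3) := by
    rw [hμ _ (hQ _ hms).1, (hQ _ hms).2]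
  have hpos : ∀ᵐ x ∂μ, 0 < x := by
    rw [ae_iff]
    simp only [not_lt]
    exact (hμ 0 (by simp)).trans (by simp [hF0])
  have hle1 : ∀ᵐ x ∂μ, x ≤ 1 := by
    refine (prob_compl_eq_zero_iff measurableSet_Iic).2 ?_
    rw [hμ 1 (by simp), hF1, ENNReal.ofReal_one]
  have hlog : Integrable Real.log μ := by
    rw [← map_quantile hF0 hF1 hFmono hQ μ hμ, integrable_map_measure
      Real.measurable_log.aestronglyMeasurable (aemeasurable_quantile hFmono hQ)]
    exact integrable_log_comp_quantile hFmono hQ hlogI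
  refine ⟨?_, fun U hU hUsub hVU hπU => ?_⟩
  · have hbound : V ⊆ ((fun q => q.1) ⁻¹' Iic (I (t / 3)) ∪ (fun q => q.2.1) ⁻¹' Iic (I (t / 3)))
        ∪ (fun q => q.2.2) ⁻¹' Iic (I (t / 3)) := by
      rw [hV]
      rintro q ((⟨h, -, -⟩ | ⟨-, h, -⟩) | ⟨-, -, h⟩)
      · exact Or.inl (Or.inl h.2)
      · exact Or.inl (Or.inr h.2)
      · exact Or.inr h.2
    refine (measure_mono hbound).trans ((measure_union_le _ _).trans
      ((add_le_add_left (measure_union_le _ _) _).trans ?_))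
    rw [← Measure.map_apply hm1 measurableSet_Iic, ← Measure.map_apply hm2 measurableSet_Iic,
      ← Measure.map_apply hm3 measurableSet_Iic, hπ1, hπ2, hπ3, hlow,
      ← ENNReal.ofReal_add hs0 hs0, ← ENNReal.ofReal_add (by linarith) hs0]
    exact ENNReal.ofReal_le_ofReal (by linarith)
  have hpos1 : ∀ᵐ q ∂π, 0 < q.1 := ae_of_ae_map hm1.aemeasurable (hπ1 ▸ hpos)
  have hpos2 : ∀ᵐ q ∂π, 0 < q.2.1 := ae_of_ae_map hm2.aemeasurable (hπ2 ▸ hpos)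
  have hpos3 : ∀ᵐ q ∂π, 0 < q.2.2 := ae_of_ae_map hm3.aemeasurable (hπ3 ▸ hpos)
  have hle1₁ : ∀ᵐ q ∂π, q.1 ≤ 1 := ae_of_ae_map hm1.aemeasurable (hπ1 ▸ hle1)
  have hle1₂ : ∀ᵐ q ∂π, q.2.1 ≤ 1 := ae_of_ae_map hm2.aemeasurable (hπ2 ▸ hle1)
  have hle1₃ : ∀ᵐ q ∂π, q.2.2 ≤ 1 := ae_of_ae_map hm3.aemeasurable (hπ3 ▸ hle1)
  have hi1 : Integrable (fun q : ℝ × ℝ × ℝ => Real.log q.1) π :=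
    Integrable.comp_measurable (g := Real.log) (hπ1 ▸ hlog) hm1
  have hi2 : Integrable (fun q : ℝ × ℝ × ℝ => Real.log q.2.1) π :=
    Integrable.comp_measurable (g := Real.log) (hπ2 ▸ hlog) hm2
  have hi3 : Integrable (fun q : ℝ × ℝ × ℝ => Real.log q.2.2) π :=
    Integrable.comp_measurable (g := Real.log) (hπ3 ▸ hlog) hm3
  have hπU' : π U = ENNReal.ofReal (3 * (t / 3)) := by
    rw [hπU]
    congr 1
    ring
  have hlow1 : ∀ᵐ q ∂π, q.1 ≤ I (t / 3) → q ∈ U := by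
    filter_upwards [hpos1, hpos2, hpos3, hle1₂, hle1₃] with q p1 p2 p3 l2 l3 h
    refine hVU (hV ▸ Or.inl (Or.inl ?_))
    exact ⟨⟨p1.le, h⟩, ⟨p2.le, l2⟩, p3.le, l3⟩
  have hlow2 : ∀ᵐ q ∂π, q.2.1 ≤ I (t / 3) → q ∈ U := by
    filter_upwards [hpos1, hpos2, hpos3, hle1₁, hle1₃] with q p1 p2 p3 l1 l3 h
    refine hVU (hV ▸ Or.inl (Or.inr ?_))
    exact ⟨⟨p1.le, l1⟩, ⟨p2.le, h⟩, p3.le, l3⟩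
  have hlow3 : ∀ᵐ q ∂π, q.2.2 ≤ I (t / 3) → q ∈ U := by
    filter_upwards [hpos1, hpos2, hpos3, hle1₁, hle1₂] with q p1 p2 p3 l1 l2 h
    refine hVU (hV ▸ Or.inr ?_)
    exact ⟨⟨p1.le, l1⟩, ⟨p2.le, l2⟩, p3.le, h⟩
  have hsplit : ∫ q in U, Real.log (q.1 * q.2.1 * q.2.2) ∂π
      = ∫ q in U, (Real.log q.1 + Real.log q.2.1 + Real.log q.2.2) ∂π := by
    refine integral_congr_ae (ae_restrict_of_ae ?_)
    filter_upwards [hpos1, hpos2, hpos3] with q p1 p2 p3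
    rw [Real.log_mul (mul_pos p1 p2).ne' p3.ne', Real.log_mul p1.ne' p2.ne']
  have hi12 : IntegrableOn (fun q : ℝ × ℝ × ℝ => Real.log q.1 + Real.log q.2.1) U π :=
    (hi1.add hi2).integrableOn
  rw [hsplit, integral_add hi12 hi3.integrableOn, integral_add hi1.integrableOn hi2.integrableOn]
  have h1 := setIntegral_log_le hF0 hF1 hFmono hQ hlogI μ hμ hm1 hπ1 hpos1 hi1 hs0 hs hU hπU' hlow1
  have h2 := setIntegral_log_le hF0 hF1 hFmono hQ hlogI μ hμ hm2 hπ2 hpos2 hi2 hs0 hs hU hπU' hlow2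
  have h3 := setIntegral_log_le hF0 hF1 hFmono hQ hlogI μ hμ hm3 hπ3 hpos3 hi3 hs0 hs hU hπU' hlow3
  linarith
end

section
/- Let F be a cumulative distribution function on [0,1] that is continuous and strictly increasing, with quantile function I = F⁻¹ and continuous density f. Let p̲ ∈ (0, 1/3] satisfy (1/3 − p̲) · log( I(p̲)·I(1−2p̲)² ) = ∫_{p̲}^{1−2p̲} log I(p) dp, set p̄ := 1 − 2p̲ and C := I(p̲)·I(p̄)², and assume x ↦ x·f(x) is nondecreasing on the interval [I(p̲), I(p̄)]. Define M ⊆ [0,1]³ by M := { (I(p), I(1−2p), I(1−2p)) : p ∈ [0, p̲) } ∪ { (I(1−2p), I(p), I(1−2p)) : p ∈ [0, p̲) } ∪ { (I(1−2p), I(1−2p), I(p)) : p ∈ [0, p̲) } ∪ { (x₁,x₂,z) ∈ [I(p̲), I(p̄)]³ : x₁·x₂·z = C }. Then there exists a Borel probability measure π on [0,1]³ whose three one-dimensional marginals all equal the measure with CDF F and with π(M) = 1. -/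
open MeasureTheory Set

open scoped Topology CompactlySupported BoundedContinuousFunction

/-- A linear functional that is nonnegative on the preimage of the nonnegative functions under a
linear map `T` into the continuous functions on a compact space is integration of `T v` against
some finite measure. -/
theorem exists_measure_integral_eq {X V : Type*} [TopologicalSpace X] [T2Space X] [CompactSpace X]
    [MeasurableSpace X] [BorelSpace X] [AddCommGroup V] [Module ℝ V]
    (T : V →ₗ[ℝ] C_c(X, ℝ)) (l : V →ₗ[ℝ] ℝ)
    (hpos : ∀ v, (∀ x, 0 ≤ T v x) → 0 ≤ l v) (hone : ∃ v, ∀ x, T v x = 1) :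
    ∃ ν : Measure X, IsFiniteMeasure ν ∧ ∀ v, ∫ x, T v x ∂ν = l v := by
  have hker : LinearMap.ker T ≤ LinearMap.ker l := by
    intro v hv
    rw [LinearMap.mem_ker] at hv ⊢
    have h1 : 0 ≤ l v := hpos v fun x => by simp [hv]
    have h2 : 0 ≤ l (-v) := hpos (-v) fun x => by simp [hv]
    rw [map_neg] at h2
    linarith
  let g : LinearMap.range T →ₗ[ℝ] ℝ :=
    ((LinearMap.ker T).liftQ l hker).comp T.quotKerEquivRange.symm.toLinearMap
  have hg : ∀ v, g ⟨T v, LinearMap.mem_range_self T v⟩ = l v := by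
    intro v
    have : T.quotKerEquivRange.symm ⟨T v, LinearMap.mem_range_self T v⟩
        = (LinearMap.ker T).mkQ v := by
      rw [LinearEquiv.symm_apply_eq]
      rfl
    simp [g, this]
  obtain ⟨w, hw⟩ := hone
  let s : PointedCone ℝ C_c(X, ℝ) :=
    { carrier := {u | ∀ x, 0 ≤ u x}
      add_mem' := fun hu hv x => add_nonneg (hu x) (hv x)
      zero_mem' := fun _ => le_rfl
      smul_mem' := fun c _ hu x => mul_nonneg c.2 (hu x) }
  obtain ⟨G, hGg, hGpos⟩ := riesz_extension s
    ⟨LinearMap.range T, g⟩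
    (by
      rintro ⟨_, v, rfl⟩ hv
      have := hpos v (fun x => hv x)
      rw [← hg] at this
      exact this)
    (by
      intro y
      obtain ⟨B, hB⟩ := (isCompact_range y.continuous).bddBelow
      refine ⟨⟨T ((-B) • w), LinearMap.mem_range_self T _⟩, ?_⟩
      intro x
      have : B ≤ y x := hB (mem_range_self x)
      simp [hw]
      linarith)
  let Λ : C_c(X, ℝ) →ₚ[ℝ] ℝ := PositiveLinearMap.mk₀ G fun x hx => hGpos x hx
  refine ⟨RealRMK.rieszMeasure Λ, inferInstance, fun v => ?_⟩
  rw [RealRMK.integral_rieszMeasure, ← hg]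
  exact hGg ⟨T v, LinearMap.mem_range_self T v⟩

/-- Duality for three equal marginals: a finite measure `ρ` on `ℝ` is the common marginal of a
measure concentrated on a cyclically invariant compact set `K` as soon as every bounded continuous
`φ` with `φ x + φ y + φ z ≥ 0` on `K` has nonnegative integral. -/
theorem exists_measure_marginals_eq {K : Set (ℝ × ℝ × ℝ)} (hK : IsCompact K)
    (hrot : ∀ q ∈ K, (q.2.1, q.2.2, q.1) ∈ K) (ρ : Measure ℝ) [IsFiniteMeasure ρ]
    (h : ∀ φ : ℝ →ᵇ ℝ, (∀ q ∈ K, 0 ≤ φ q.1 + φ q.2.1 + φ q.2.2) → 0 ≤ ∫ x, φ x ∂ρ) :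
    ∃ π : Measure (ℝ × ℝ × ℝ), π Kᶜ = 0 ∧ π.map (fun q => q.1) = ρ
      ∧ π.map (fun q => q.2.1) = ρ ∧ π.map (fun q => q.2.2) = ρ := by
  have : CompactSpace K := isCompact_iff_compactSpace.1 hK
  let T : (ℝ →ᵇ ℝ) →ₗ[ℝ] C_c(K, ℝ) :=
    { toFun := fun φ => CompactlySupportedContinuousMap.continuousMapEquiv
        ⟨fun q : K => φ q.1.1 + φ q.1.2.1 + φ q.1.2.2, by fun_prop⟩
      map_add' := fun φ ψ => by
        ext q
        change (φ + ψ) q.1.1 + (φ + ψ) q.1.2.1 + (φ + ψ) q.1.2.2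
          = (φ q.1.1 + φ q.1.2.1 + φ q.1.2.2) + (ψ q.1.1 + ψ q.1.2.1 + ψ q.1.2.2)
        simp only [BoundedContinuousFunction.coe_add, Pi.add_apply]
        ring
      map_smul' := fun c φ => by
        ext q
        change (c • φ) q.1.1 + (c • φ) q.1.2.1 + (c • φ) q.1.2.2
          = c * (φ q.1.1 + φ q.1.2.1 + φ q.1.2.2)
        simp only [BoundedContinuousFunction.coe_smul, smul_eq_mul]
        ring }
  have hT : ∀ φ (q : K), T φ q = φ q.1.1 + φ q.1.2.1 + φ q.1.2.2 := fun _ _ => rfl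
  let l : (ℝ →ᵇ ℝ) →ₗ[ℝ] ℝ :=
    { toFun := fun φ => ∫ x, φ x ∂ρ
      map_add' := fun φ ψ => integral_add (φ.integrable ρ) (ψ.integrable ρ)
      map_smul' := fun c φ => integral_const_mul c _ }
  obtain ⟨ν, hν, hint⟩ := exists_measure_integral_eq T l
    (fun φ hφ => h φ fun q hq => hφ ⟨q, hq⟩)
    ⟨BoundedContinuousFunction.const ℝ (1 / 3), fun q => by rw [hT]; simp; norm_num⟩
  let σ : Measure (ℝ × ℝ × ℝ) := ν.map Subtype.val
  have hσK : σ Kᶜ = 0 := by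
    rw [Measure.map_apply measurable_subtype_coe hK.measurableSet.compl]
    convert measure_empty (μ := ν)
    ext q
    simp
  have hσint : ∀ φ : ℝ →ᵇ ℝ,
      ∫ q, φ q.1 ∂σ + ∫ q, φ q.2.1 ∂σ + ∫ q, φ q.2.2 ∂σ = ∫ x, φ x ∂ρ := by
    intro φ
    have hi : ∀ g : ℝ × ℝ × ℝ → ℝ, Continuous g → Integrable (fun q => φ (g q)) σ := fun g hg =>
      (φ.compContinuous ⟨g, hg⟩).integrable σ
    have h1 := hi (fun q => q.1) (by fun_prop)
    have h2 := hi (fun q => q.2.1) (by fun_prop)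
    have h3 := hi (fun q => q.2.2) (by fun_prop)
    have h12 : Integrable (fun q => φ q.1 + φ q.2.1) σ := h1.add h2
    rw [← integral_add h1 h2, ← integral_add h12 h3,
      integral_map (by fun_prop) (by fun_prop)]
    exact hint φ
  have hsum : σ.map (fun q => q.1) + σ.map (fun q => q.2.1) + σ.map (fun q => q.2.2) = ρ := by
    refine ext_of_forall_integral_eq_of_IsFiniteMeasure fun φ => ?_
    rw [integral_add_measure ((φ.integrable _).add_measure (φ.integrable _)) (φ.integrable _),
      integral_add_measure (φ.integrable _) (φ.integrable _)]
    have hm : ∀ g : ℝ × ℝ × ℝ → ℝ, Continuous g →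
        ∫ x, φ x ∂(σ.map g) = ∫ q, φ (g q) ∂σ := fun g hg =>
      integral_map hg.aemeasurable φ.continuous.aestronglyMeasurable
    rw [hm _ (by fun_prop), hm _ (by fun_prop), hm _ (by fun_prop)]
    exact hσint φ
  let r : ℝ × ℝ × ℝ → ℝ × ℝ × ℝ := fun q => (q.2.1, q.2.2, q.1)
  have hr : Measurable r := by fun_prop
  have hpre : ∀ τ : Measure (ℝ × ℝ × ℝ), τ Kᶜ = 0 → τ.map r Kᶜ = 0 := by
    intro τ hτ
    rw [Measure.map_apply hr hK.measurableSet.compl]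
    refine measure_mono_null (fun q hq hqK => hq (hrot q hqK)) hτ
  refine ⟨σ + σ.map r + (σ.map r).map r, ?_, ?_, ?_, ?_⟩
  · simp [hσK, hpre σ hσK, hpre _ (hpre σ hσK)]
  all_goals
    rw [Measure.map_add _ _ (by fun_prop), Measure.map_add _ _ (by fun_prop),
      Measure.map_map (by fun_prop) hr, Measure.map_map (by fun_prop) hr,
      Measure.map_map (by fun_prop) hr, ← hsum]
    simp only [r, Function.comp_def]
  · rw [add_right_comm, add_assoc, add_comm, add_assoc]
    abel
  · abel

/-- Abel summation for integrals: a continuous function with nonnegative primitive has nonnegative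
integral against every nonnegative antitone continuous weight. -/
theorem integral_mul_nonneg_of_antitoneOn {h ψ : ℝ → ℝ} (hh : AntitoneOn h (Icc 0 1))
    (hhc : ContinuousOn h (Icc 0 1)) (h1 : 0 ≤ h 1) (hψ : Continuous ψ)
    (hΨ : ∀ t ∈ Icc (0 : ℝ) 1, 0 ≤ ∫ x in (0 : ℝ)..t, ψ x) :
    0 ≤ ∫ x in (0 : ℝ)..1, ψ x * h x := by
  obtain ⟨B, hB⟩ := (isCompact_Icc (a := (0 : ℝ)) (b := 1)).exists_bound_of_continuousOn
    hψ.continuousOn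
  have hB0 : 0 ≤ B := (norm_nonneg _).trans (hB 0 (by simp))
  have hint : ∀ a ∈ Icc (0 : ℝ) 1, ∀ b ∈ Icc (0 : ℝ) 1,
      IntervalIntegrable (fun x => ψ x * h x) volume a b := fun a ha b hb =>
    ((hψ.continuousOn.mul hhc).mono (uIcc_subset_Icc ha hb)).intervalIntegrable
  have hψint : ∀ a b, IntervalIntegrable ψ volume a b := fun a b => hψ.intervalIntegrable a b
  have step : ∀ n : ℕ, 0 < n → -(B * (h 0 - h 1) / n) ≤ ∫ x in (0 : ℝ)..1, ψ x * h x := by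
    intro n hn
    have hn' : (0 : ℝ) < n := by exact_mod_cast hn
    have hmem : ∀ j : ℕ, j ≤ n → (j / n : ℝ) ∈ Icc (0 : ℝ) 1 := fun j hj =>
      ⟨by positivity, (div_le_one hn').2 (by exact_mod_cast hj)⟩
    have key : ∀ j : ℕ, j ≤ n → h (j / n) * (∫ x in (0 : ℝ)..(j / n), ψ x)
        - B * (h 0 - h (j / n)) / n ≤ ∫ x in (0 : ℝ)..(j / n), ψ x * h x := by
      intro j
      induction j with
      | zero => intro _; simp
      | succ j ih =>
        intro hj
        have ih := ih (by omega)
        have m0 := hmem j (by omega)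
        have m1 := hmem (j + 1) hj
        have hle : (j / n : ℝ) ≤ ((j + 1 : ℕ) : ℝ) / n := by
          gcongr; simp
        have hd : ((j + 1 : ℕ) : ℝ) / n - j / n = 1 / n := by
          push_cast; field_simp; ring
        set u : ℝ := j / n
        set v : ℝ := ((j + 1 : ℕ) : ℝ) / n
        have e1 := intervalIntegral.integral_add_adjacent_intervals
          (hint 0 (by simp) u m0) (hint u m0 v m1)
        have e2 := intervalIntegral.integral_add_adjacent_intervals (hψint 0 u) (hψint u v)
        have hmono : h v ≤ h u := hh m0 m1 hle
        have e3 : h u * (∫ x in u..v, ψ x) - B * (h u - h v) / n ≤ ∫ x in u..v, ψ x * h x := by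
          have : h u * (∫ x in u..v, ψ x) - B * (h u - h v) / n
              = ∫ x in u..v, (h u * ψ x - B * (h u - h v)) := by
            rw [intervalIntegral.integral_sub ((hψint u v).const_mul _) (by simp),
              intervalIntegral.integral_const_mul, intervalIntegral.integral_const, hd, smul_eq_mul]
            ring
          rw [this]
          refine intervalIntegral.integral_mono_on hle
            (((hψint u v).const_mul _).sub (by simp)) (hint u m0 v m1) fun x hx => ?_
          have mx : x ∈ Icc (0 : ℝ) 1 := ⟨m0.1.trans hx.1, hx.2.trans m1.2⟩
          have b1 : h x ≤ h u := hh m0 mx hx.1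
          have b2 : h v ≤ h x := hh mx m1 hx.2
          have b3 := (abs_le.1 (Real.norm_eq_abs (ψ x) ▸ hB x mx)).2
          nlinarith [mul_nonneg (sub_nonneg.2 b3) (sub_nonneg.2 b1),
            mul_nonneg hB0 (sub_nonneg.2 b2)]
        have hP := hΨ v m1
        have e4 : h v * (∫ x in (0 : ℝ)..v, ψ x) ≤ h u * (∫ x in (0 : ℝ)..v, ψ x) := by
          gcongr
        have e5 : B * (h 0 - h v) / n = B * (h 0 - h u) / n + B * (h u - h v) / n := by ring
        rw [← e1, e5]
        rw [← e2] at e4 ⊢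
        linarith
    have := key n le_rfl
    rw [div_self hn'.ne'] at this
    have hP := mul_nonneg h1 (hΨ 1 (by simp))
    linarith
  have ht : Filter.Tendsto (fun n : ℕ => -(B * (h 0 - h 1) / n)) Filter.atTop (𝓝 0) := by
    simpa using (tendsto_const_div_atTop_nhds_zero_nat (B * (h 0 - h 1))).neg
  exact le_of_tendsto ht (Filter.eventually_atTop.2 ⟨1, fun m hm => step m hm⟩)

/-- There is no continuous function, bounded below by a positive constant in mean over each point
of the simplex, whose primitive on `[0, 1]` is nonnegative and vanishes on both sides of `2/3`. -/
theorem false_of_primitive_eq_zero {χ : ℝ → ℝ} (hχ : Continuous χ) {ε s t : ℝ} (hε : 0 < ε)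
    (hsum : ∀ x y z : ℝ, 0 ≤ x → 0 ≤ y → 0 ≤ z → x + y + z = 1 → ε ≤ χ x + χ y + χ z)
    (hP : ∀ x ∈ Icc (0 : ℝ) 1, 0 ≤ ∫ r in (0 : ℝ)..x, χ r)
    (hs : s ∈ Icc (0 : ℝ) (2 / 3)) (ht : t ∈ Icc (2 / 3 : ℝ) 1)
    (hPs : ∫ r in (0 : ℝ)..s, χ r = 0) (hPt : ∫ r in (0 : ℝ)..t, χ r = 0)
    (h0 : s = 0 → χ 0 = 0) : False := by
  obtain ⟨hs0, hs1⟩ := hs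
  obtain ⟨ht0, ht1⟩ := ht
  have hint : ∀ a b, IntervalIntegrable χ volume a b := fun a b => hχ.intervalIntegrable a b
  have hsub : ∀ a b, ∫ r in a..b, χ r = (∫ r in (0 : ℝ)..b, χ r) - ∫ r in (0 : ℝ)..a, χ r :=
    fun a b => (intervalIntegral.integral_interval_sub_left (hint _ _) (hint _ _)).symm
  have avg : ∀ x x' y y' z z' : ℝ,
      (∀ r ∈ Icc (0 : ℝ) 1, 0 ≤ x + x' * r ∧ 0 ≤ y + y' * r ∧ 0 ≤ z + z' * r
        ∧ (x + x' * r) + (y + y' * r) + (z + z' * r) = 1) →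
      ε ≤ (∫ r in (0 : ℝ)..1, χ (x + x' * r)) + (∫ r in (0 : ℝ)..1, χ (y + y' * r))
        + ∫ r in (0 : ℝ)..1, χ (z + z' * r) := by
    intro x x' y y' z z' hr
    have hi : ∀ x x' : ℝ, IntervalIntegrable (fun r => χ (x + x' * r)) volume 0 1 := fun x x' =>
      Continuous.intervalIntegrable (by fun_prop) _ _
    rw [← intervalIntegral.integral_add (hi _ _) (hi _ _),
      ← intervalIntegral.integral_add ((hi _ _).add (hi _ _)) (hi _ _)]
    have : ∫ r in (0 : ℝ)..1, ε = ε := by simp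
    rw [← this]
    refine intervalIntegral.integral_mono_on zero_le_one (by simp)
      (((hi _ _).add (hi _ _)).add (hi _ _)) fun r hr' => ?_
    obtain ⟨a, b, c, d⟩ := hr r hr'
    exact hsum _ _ _ a b c d
  have aff : ∀ x x' : ℝ, x' ≠ 0 → ∫ r in (0 : ℝ)..1, χ (x + x' * r)
      = x'⁻¹ * ((∫ r in (0 : ℝ)..(x + x'), χ r) - ∫ r in (0 : ℝ)..x, χ r) := by
    intro x x' hx'
    rw [intervalIntegral.integral_comp_add_mul χ hx', hsub]
    simp
  by_cases c1 : 1 / 3 < s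
  · have hd : 0 < s - 1 / 3 := by linarith
    have A := avg (2 / 3 - s) (2 * (s - 1 / 3)) s (-(s - 1 / 3)) (1 / 3) (-(s - 1 / 3)) (by
      rintro r ⟨hr0, hr1⟩
      refine ⟨?_, ?_, ?_, by ring⟩ <;> nlinarith)
    rw [aff _ _ (by linarith), aff _ _ (by linarith), aff _ _ (by linarith)] at A
    have e1 : 2 / 3 - s + 2 * (s - 1 / 3) = s := by ring
    have e2 : s + -(s - 1 / 3) = 1 / 3 := by ring
    have e3 : 1 / 3 + -(s - 1 / 3) = 2 / 3 - s := by ring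
    have hp := hP (2 / 3 - s) ⟨by linarith, by linarith⟩
    have hinv := inv_pos.2 hd
    rw [e1, e2, e3, hPs, mul_inv, inv_neg] at A
    nlinarith [mul_nonneg hinv.le hp]
  by_cases c2 : (1 - t) / 2 < s
  · have hd : 0 < s - (1 - t) / 2 := by linarith
    have A := avg t (-(2 * (s - (1 - t) / 2))) ((1 - t) / 2) (s - (1 - t) / 2)
      ((1 - t) / 2) (s - (1 - t) / 2) (by
      rintro r ⟨hr0, hr1⟩
      refine ⟨?_, ?_, ?_, by ring⟩ <;> nlinarith)
    rw [aff _ _ (by linarith), aff _ _ (by linarith)] at A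
    have e1 : t + -(2 * (s - (1 - t) / 2)) = 1 - 2 * s := by ring
    have e2 : (1 - t) / 2 + (s - (1 - t) / 2) = s := by ring
    have hp := hP ((1 - t) / 2) ⟨by linarith, by linarith⟩
    have hq := hP (1 - 2 * s) ⟨by linarith, by linarith⟩
    have hinv := inv_pos.2 hd
    rw [e1, e2, hPs, hPt, inv_neg, mul_inv] at A
    nlinarith [mul_nonneg hinv.le hp, mul_nonneg hinv.le hq]
  · have hχs : χ s = 0 := by
      rcases hs0.eq_or_lt with hs' | hs'
      · rw [← hs']; exact h0 hs'.symm
      · have hmin : IsLocalMin (fun x => ∫ r in (0 : ℝ)..x, χ r) s := by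
          filter_upwards [Icc_mem_nhds hs' (by linarith : s < 1)] with x hx
          rw [hPs]
          exact hP x hx
        exact hmin.hasDerivAt_eq_zero (hχ.integral_hasStrictDerivAt 0 s).hasDerivAt
    have hd : 0 < 2 * t - 1 + s := by linarith
    have A := avg s 0 t (-(2 * t - 1 + s)) (1 - s - t) (2 * t - 1 + s) (by
      rintro r ⟨hr0, hr1⟩
      refine ⟨?_, ?_, ?_, by ring⟩ <;> nlinarith)
    rw [aff t _ (by linarith), aff (1 - s - t) _ hd.ne'] at A
    have e1 : t + -(2 * t - 1 + s) = 1 - s - t := by ring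
    have e2 : 1 - s - t + (2 * t - 1 + s) = t := by ring
    have hp := hP (1 - s - t) ⟨by linarith, by linarith⟩
    have hinv := inv_pos.2 hd
    simp only [zero_mul, add_zero, intervalIntegral.integral_const, hχs] at A
    rw [e1, e2, hPt, inv_neg] at A
    simp only [smul_zero, zero_add] at A
    nlinarith [mul_nonneg hinv.le hp]

/-- A nonnegative antitone continuous weight on `[0, 1]` with mean `1/3` integrates nonnegatively
every continuous function whose sums over the points of the simplex are nonnegative. -/
theorem integral_mul_nonneg_of_simplex {h φ : ℝ → ℝ} (hh : AntitoneOn h (Icc 0 1))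
    (hhc : ContinuousOn h (Icc 0 1)) (h1 : 0 ≤ h 1)
    (hmean : ∫ x in (0 : ℝ)..1, x * h x = 1 / 3 * ∫ x in (0 : ℝ)..1, h x) (hφ : Continuous φ)
    (hsum : ∀ x y z : ℝ, 0 ≤ x → 0 ≤ y → 0 ≤ z → x + y + z = 1 → 0 ≤ φ x + φ y + φ z) :
    0 ≤ ∫ x in (0 : ℝ)..1, φ x * h x := by
  let G : ℝ → ℝ := fun t => ∫ r in (0 : ℝ)..1, φ (t * r)
  have hG : Continuous G :=
    intervalIntegral.continuous_parametric_intervalIntegral_of_continuous' (by fun_prop) 0 1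
  have hGt : ∀ t, t * G t = ∫ r in (0 : ℝ)..t, φ r := fun t => by
    have := intervalIntegral.mul_integral_comp_mul_left (f := φ) (a := 0) (b := 1) t
    rwa [mul_zero, mul_one] at this
  let m : ℝ → ℝ → ℝ := fun c t => G t - c * (t - 2 / 3)
  have hm : Continuous ↿m := by
    change Continuous fun p : ℝ × ℝ => G p.2 - p.1 * (p.2 - 2 / 3)
    fun_prop
  have hmc : ∀ c, Continuous (m c) := fun c => by
    change Continuous fun t => G t - c * (t - 2 / 3)
    fun_prop
  have hl : (Icc (0 : ℝ) (2 / 3)).Nonempty := nonempty_Icc.2 (by norm_num)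
  have hr : (Icc (2 / 3 : ℝ) 1).Nonempty := nonempty_Icc.2 (by norm_num)
  obtain ⟨B, hB⟩ := (isCompact_Icc (a := (0 : ℝ)) (b := 1)).exists_bound_of_continuousOn
    hG.continuousOn
  have hB' : ∀ t ∈ Icc (0 : ℝ) 1, -B ≤ G t ∧ G t ≤ B := fun t ht =>
    abs_le.1 (Real.norm_eq_abs (G t) ▸ hB t ht)
  have hB0 : 0 ≤ B := (norm_nonneg _).trans (hB 0 (by simp))
  let ml : ℝ → ℝ := fun c => sInf (m c '' Icc 0 (2 / 3))
  let mr : ℝ → ℝ := fun c => sInf (m c '' Icc (2 / 3) 1)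
  have hml : Continuous ml := isCompact_Icc.continuous_sInf hm
  have hmr : Continuous mr := isCompact_Icc.continuous_sInf hm
  have ml_le : ∀ c, ∀ t ∈ Icc (0 : ℝ) (2 / 3), ml c ≤ m c t := fun c t ht =>
    csInf_le (isCompact_Icc.image (hmc c)).bddBelow (mem_image_of_mem _ ht)
  have mr_le : ∀ c, ∀ t ∈ Icc (2 / 3 : ℝ) 1, mr c ≤ m c t := fun c t ht =>
    csInf_le (isCompact_Icc.image (hmc c)).bddBelow (mem_image_of_mem _ ht)
  have hpos : mr (6 * B) ≤ ml (6 * B) := by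
    refine (mr_le _ 1 (by norm_num)).trans (le_csInf (hl.image _) ?_)
    rintro _ ⟨t, ⟨ht0, ht1⟩, rfl⟩
    have := (hB' t ⟨ht0, by linarith⟩).1
    have := (hB' 1 (by simp)).2
    simp only [m]
    nlinarith
  have hneg : ml (-(6 * B)) ≤ mr (-(6 * B)) := by
    refine (ml_le _ 0 (by norm_num)).trans (le_csInf (hr.image _) ?_)
    rintro _ ⟨t, ⟨ht0, ht1⟩, rfl⟩
    have := (hB' t ⟨by linarith, ht1⟩).1
    have := (hB' 0 (by simp)).2
    simp only [m]
    nlinarith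
  obtain ⟨c, -, hc⟩ : ∃ c ∈ Icc (-(6 * B)) (6 * B), ml c - mr c = 0 :=
    intermediate_value_Icc (by linarith) (hml.sub hmr).continuousOn
      ⟨by simpa using hneg, by simpa using hpos⟩
  obtain ⟨s, hs, hsm⟩ := (isCompact_Icc.image (hmc c)).sInf_mem (hl.image _)
  obtain ⟨t, ht, htm⟩ := (isCompact_Icc.image (hmc c)).sInf_mem (hr.image _)
  change m c s = ml c at hsm
  change m c t = mr c at htm
  have hmin : ∀ x ∈ Icc (0 : ℝ) 1, ml c ≤ m c x := by
    intro x hx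
    rcases le_total x (2 / 3) with h | h
    · exact ml_le c x ⟨hx.1, h⟩
    · have := mr_le c x ⟨h, hx.2⟩
      linarith
  have hprim : ∀ v x : ℝ, ∫ r in (0 : ℝ)..x, (φ r - (2 * c) * (r - 1 / 3) - v)
      = x * (m c x - v) := by
    intro v x
    rw [intervalIntegral.integral_sub (Continuous.intervalIntegrable (by fun_prop) _ _) (by simp),
      intervalIntegral.integral_sub (hφ.intervalIntegrable _ _)
        (Continuous.intervalIntegrable (by fun_prop) _ _),
      intervalIntegral.integral_const_mul,
      intervalIntegral.integral_sub (Continuous.intervalIntegrable (by fun_prop) _ _) (by simp),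
      integral_id, ← hGt]
    simp [m]
    ring
  have hint : ∀ ψ : ℝ → ℝ, Continuous ψ →
      IntervalIntegrable (fun x => ψ x * h x) volume 0 1 := fun ψ hψ =>
    (hψ.continuousOn.mul (hhc.mono (by simp))).intervalIntegrable
  rcases le_or_gt 0 (ml c) with hv | hv
  · have key := integral_mul_nonneg_of_antitoneOn hh hhc h1
      (ψ := fun r => φ r - (2 * c) * (r - 1 / 3) - 0) (by fun_prop) (fun x hx => by
        rw [hprim]
        exact mul_nonneg hx.1 (by linarith [hmin x hx]))
    have e : ∀ x, (φ x - (2 * c) * (x - 1 / 3) - 0) * h x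
        = φ x * h x - (2 * c) * (x * h x - 1 / 3 * h x) := fun x => by ring
    have hh1 : IntervalIntegrable h volume 0 1 := by
      simpa using hint (fun _ => 1) continuous_const
    have hxh := hint (fun x => x) continuous_id
    simp only [e] at key
    rwa [intervalIntegral.integral_sub (hint φ hφ) ((hxh.sub (hh1.const_mul _)).const_mul _),
      intervalIntegral.integral_const_mul, intervalIntegral.integral_sub hxh (hh1.const_mul _),
      intervalIntegral.integral_const_mul, hmean, sub_self, mul_zero, sub_zero] at key
  · exfalso
    refine false_of_primitive_eq_zero (χ := fun r => φ r - (2 * c) * (r - 1 / 3) - ml c)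
      (ε := -(3 * ml c)) (by fun_prop) (by linarith) ?_ ?_ hs ht ?_ ?_ ?_
    · intro x y z hx hy hz hxyz
      have := hsum x y z hx hy hz hxyz
      have e : c * x + c * y + c * z = c := by rw [← mul_add, ← mul_add, hxyz, mul_one]
      linarith
    · intro x hx
      rw [hprim]
      exact mul_nonneg hx.1 (by linarith [hmin x hx])
    · rw [hprim, hsm]; ring
    · rw [hprim, htm]; linear_combination (-t) * hc
    · rintro rfl
      have : G 0 = φ 0 := by simp [G]
      rw [← hsm]
      simp only [m, this]
      ring

/-- If `x * f x` is monotone on `[a, b]` and the logarithmic mean is `log (a * b ^ 2) / 3`, then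
every continuous `φ` with `φ x + φ y + φ z ≥ 0` whenever `x * y * z = a * b ^ 2` has nonnegative
integral against the distribution with quantile function `J`. -/
theorem integral_comp_quantile_nonneg {F f J φ : ℝ → ℝ} {a b : ℝ} (ha : 0 < a) (hab : a < b)
    (hJ : Continuous J) (hJF : ∀ x ∈ Icc a b, J (F x) = x)
    (hF : ∀ x ∈ Icc a b, HasDerivWithinAt F (f x) (Icc a b) x) (hf : ContinuousOn f (Icc a b))
    (hFm : MonotoneOn F (Icc a b)) (hxf : MonotoneOn (fun x => x * f x) (Icc a b))
    (hlog : (F b - F a) / 3 * Real.log (a * b ^ 2) = ∫ p in F a..F b, Real.log (J p))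
    (hφ : Continuous φ)
    (hsum : ∀ x ∈ Icc a b, ∀ y ∈ Icc a b, ∀ z ∈ Icc a b, x * y * z = a * b ^ 2 →
      0 ≤ φ x + φ y + φ z) :
    0 ≤ ∫ p in F a..F b, φ (J p) := by
  have hb : 0 < b := ha.trans hab
  set L := Real.log b - Real.log a with hL
  have hL0 : 0 < L := sub_pos.2 (Real.log_lt_log ha hab)
  let X : ℝ → ℝ := fun w => b * Real.exp (-(L * w))
  have hX0 : X 0 = b := by simp [X]
  have hX1 : X 1 = a := by
    simp only [X, hL, mul_one, neg_sub, Real.exp_sub, Real.exp_log ha, Real.exp_log hb]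
    field_simp
  have hXanti : StrictAnti X := fun u v huv => by
    change b * Real.exp (-(L * v)) < b * Real.exp (-(L * u))
    gcongr
  have hXc : Continuous X := by fun_prop
  have hXmem : ∀ w ∈ Icc (0 : ℝ) 1, X w ∈ Icc a b := fun w hw =>
    ⟨hX1 ▸ hXanti.antitone hw.2, hX0 ▸ hXanti.antitone hw.1⟩
  have hXd : ∀ w, HasDerivAt X (-(L * X w)) w := fun w => by
    refine HasDerivAt.congr_deriv (((hasDerivAt_id w).const_mul L).neg.exp.const_mul b) ?_
    simp only [X, id, Pi.neg_apply]
    ring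
  let h : ℝ → ℝ := fun w => L * (X w * f (X w))
  have hfX : ContinuousOn (fun w => f (X w)) (Icc 0 1) :=
    hf.comp hXc.continuousOn hXmem
  have hFc : ContinuousOn F (Icc a b) := fun x hx => (hF x hx).continuousWithinAt
  have sub : ∀ γ : ℝ → ℝ, ContinuousOn γ (Icc a b) →
      ∫ p in F a..F b, γ (J p) = ∫ w in (0 : ℝ)..1, γ (X w) * h w := by
    intro γ hγ
    have himg : (fun w => F (X w)) '' uIcc 0 1 ⊆ F '' Icc a b := by
      rintro _ ⟨w, hw, rfl⟩
      rw [uIcc_of_le zero_le_one] at hw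
      exact mem_image_of_mem F (hXmem w hw)
    have := intervalIntegral.integral_comp_mul_deriv'' (a := 0) (b := 1)
      (f := fun w => F (X w)) (f' := fun w => f (X w) * (-(L * X w))) (g := fun p => γ (J p))
      (by
        rw [uIcc_of_le zero_le_one]
        exact hFc.comp hXc.continuousOn hXmem)
      (by
        intro w hw
        rw [min_eq_left zero_le_one, max_eq_right zero_le_one] at hw
        have hXw : Icc a b ∈ 𝓝 (X w) := Icc_mem_nhds (hX1 ▸ hXanti hw.2) (hX0 ▸ hXanti hw.1)
        exact (((hF _ (mem_of_mem_nhds hXw)).hasDerivAt hXw).comp w (hXd w)).hasDerivWithinAt)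
      (by
        rw [uIcc_of_le zero_le_one]
        exact hfX.mul (by fun_prop))
      (by
        refine ContinuousOn.mono ?_ himg
        refine hγ.comp hJ.continuousOn ?_
        rintro _ ⟨x, hx, rfl⟩
        rwa [hJF x hx])
    simp only [hX0, hX1] at this
    rw [intervalIntegral.integral_symm, ← this, ← intervalIntegral.integral_neg]
    refine intervalIntegral.integral_congr fun w hw => ?_
    rw [uIcc_of_le zero_le_one] at hw
    simp only [Function.comp_apply, hJF _ (hXmem w hw), h]
    ring
  have hhc : ContinuousOn h (Icc 0 1) := continuousOn_const.mul (hXc.continuousOn.mul hfX)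
  have hint : ∀ ψ : ℝ → ℝ, Continuous ψ →
      IntervalIntegrable (fun x => ψ x * h x) volume 0 1 := fun ψ hψ =>
    (hψ.continuousOn.mul (hhc.mono (by simp))).intervalIntegrable
  have hone : ∫ w in (0 : ℝ)..1, h w = F b - F a := by
    simpa using (sub (fun _ => 1) continuousOn_const).symm
  rw [sub φ hφ.continuousOn]
  refine integral_mul_nonneg_of_simplex (φ := fun w => φ (X w)) ?_ hhc ?_ ?_ (by fun_prop) ?_
  · intro u hu v hv huv
    exact mul_le_mul_of_nonneg_left
      (hxf (hXmem v hv) (hXmem u hu) (hXanti.antitone huv)) hL0.le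
  · have hma : a ∈ Icc a b := left_mem_Icc.2 hab.le
    have hfa : 0 ≤ f a := by
      rw [← (hF a hma).derivWithin (uniqueDiffOn_Icc hab a hma)]
      exact hFm.derivWithin_nonneg
    simp only [h, hX1]
    positivity
  · have hlogX : ∀ w, Real.log (X w) = Real.log b - L * w := fun w => by
      rw [Real.log_mul hb.ne' (Real.exp_ne_zero _), Real.log_exp]
      ring
    have e := sub Real.log (Real.continuousOn_log.mono fun x hx => (ha.trans_le hx.1).ne')
    have e' : ∀ w, (Real.log b - L * w) * h w = Real.log b * h w - L * (w * h w) := fun w => by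
      ring
    have hh1 : IntervalIntegrable h volume 0 1 := by
      simpa using hint (fun _ => 1) continuous_const
    have hxh : IntervalIntegrable (fun w => w * h w) volume 0 1 := hint _ continuous_id
    have i1 : ∫ w in (0 : ℝ)..1, Real.log b * h w = Real.log b * ∫ w in (0 : ℝ)..1, h w :=
      intervalIntegral.integral_const_mul _ _
    have i2 : ∫ w in (0 : ℝ)..1, L * (w * h w) = L * ∫ w in (0 : ℝ)..1, w * h w :=
      intervalIntegral.integral_const_mul _ _
    simp only [hlogX, e'] at e
    rw [intervalIntegral.integral_sub (hh1.const_mul _) (hxh.const_mul _),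
      i1, i2, hone, ← hlog,
      Real.log_mul ha.ne' (by positivity), Real.log_pow] at e
    rw [hone]
    refine mul_left_cancel₀ hL0.ne' ?_
    push_cast at e
    rw [hL] at e ⊢
    linear_combination e
  · intro x y z hx hy hz hxyz
    refine hsum _ (hXmem x ⟨hx, by linarith⟩) _ (hXmem y ⟨hy, by linarith⟩) _
      (hXmem z ⟨hz, by linarith⟩) ?_
    have e : X x * X y * X z = b ^ 3 * Real.exp (-(L * (x + y + z))) := by
      simp only [X]
      rw [mul_add, mul_add, neg_add, neg_add, Real.exp_add, Real.exp_add]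
      ring
    have e1 : b * Real.exp (-(L * 1)) = a := hX1
    rw [e, hxyz]
    linear_combination b ^ 2 * e1

/-- Pushing the uniform measure on `[0, 1]` forward along the quantile function of `F` gives the
measure with distribution function `F`. -/
theorem map_quantile_eq {F J : ℝ → ℝ} (hF1 : F 1 = 1) (hF0 : F 0 = 0)
    (hFm : StrictMonoOn F (Icc 0 1)) (hJ : Measurable J)
    (hQ : ∀ p ∈ Icc (0 : ℝ) 1, J p ∈ Icc (0 : ℝ) 1 ∧ F (J p) = p)
    (μ : Measure ℝ) [IsProbabilityMeasure μ]
    (hμ : ∀ x ∈ Icc (0 : ℝ) 1, μ (Iic x) = ENNReal.ofReal (F x)) :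
    (volume.restrict (Icc (0 : ℝ) 1)).map J = μ := by
  refine Measure.ext_of_Iic _ _ fun x => ?_
  rw [Measure.map_apply hJ measurableSet_Iic, Measure.restrict_apply (hJ measurableSet_Iic)]
  rcases lt_or_ge x 0 with hx | hx
  · have h1 : J ⁻¹' Iic x ∩ Icc 0 1 = ∅ := by
      ext p
      simp only [mem_inter_iff, mem_preimage, mem_Iic, mem_empty_iff_false, iff_false, not_and]
      intro hp hp'
      linarith [(hQ p hp').1.1]
    have h2 : μ (Iic x) = 0 := by
      refine measure_mono_null (Iic_subset_Iic.2 hx.le) ?_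
      rw [hμ 0 (by simp), hF0, ENNReal.ofReal_zero]
    rw [h1, h2, measure_empty]
  rcases le_or_gt x 1 with hx1 | hx1
  · have hFx : F x ∈ Icc (0 : ℝ) 1 :=
      ⟨hF0 ▸ hFm.monotoneOn (by simp) ⟨hx, hx1⟩ hx, hF1 ▸ hFm.monotoneOn ⟨hx, hx1⟩ (by simp) hx1⟩
    have h1 : J ⁻¹' Iic x ∩ Icc 0 1 = Icc 0 (F x) := by
      ext p
      simp only [mem_inter_iff, mem_preimage, mem_Iic, mem_Icc]
      constructor
      · rintro ⟨hp, hp0, hp1⟩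
        obtain ⟨hm, hq⟩ := hQ p ⟨hp0, hp1⟩
        exact ⟨hp0, hq ▸ hFm.monotoneOn hm ⟨hx, hx1⟩ hp⟩
      · rintro ⟨hp0, hp⟩
        have hp1 := hp.trans hFx.2
        obtain ⟨hm, hq⟩ := hQ p ⟨hp0, hp1⟩
        exact ⟨(hFm.le_iff_le hm ⟨hx, hx1⟩).1 (hq.trans_le hp), hp0, hp1⟩
    rw [h1, hμ x ⟨hx, hx1⟩, Real.volume_Icc, sub_zero]
  · have h1 : J ⁻¹' Iic x ∩ Icc 0 1 = Icc 0 1 :=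
      inter_eq_right.2 fun p hp => (hQ p hp).1.2.trans hx1.le
    have h2 : μ (Iic x) = 1 := by
      refine le_antisymm prob_le_one ?_
      calc (1 : ENNReal) = μ (Iic 1) := by rw [hμ 1 (by simp), hF1, ENNReal.ofReal_one]
        _ ≤ μ (Iic x) := measure_mono (Iic_subset_Iic.2 hx1.le)
    rw [h1, h2, Real.volume_Icc, sub_zero, ENNReal.ofReal_one]

/-- The map `p ↦ 1 - 2 p` sends Lebesgue measure on `[0, p₀)` to half of Lebesgue measure on
`(1 - 2 p₀, 1]`. -/
theorem two_smul_map_one_sub_two_mul (p₀ : ℝ) :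
    (volume.restrict (Ico 0 p₀)).map (fun p : ℝ => 1 - 2 * p)
      + (volume.restrict (Ico 0 p₀)).map (fun p : ℝ => 1 - 2 * p)
      = volume.restrict (Ioc (1 - 2 * p₀) 1) := by
  have hpre : (fun p : ℝ => 1 - 2 * p) ⁻¹' Ioc (1 - 2 * p₀) 1 = Ico 0 p₀ := by
    ext p
    simp only [mem_preimage, mem_Ioc, mem_Ico]
    constructor <;> rintro ⟨h1, h2⟩ <;> constructor <;> linarith
  have hmap : (volume : Measure ℝ).map (fun p : ℝ => 1 - 2 * p)
      = ENNReal.ofReal (1 / 2) • volume := by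
    have : (fun p : ℝ => 1 - 2 * p) = (fun x => 1 + x) ∘ fun p => -2 * p := by
      ext p
      simp only [Function.comp_apply]
      ring
    rw [this, ← Measure.map_map (by fun_prop) (by fun_prop),
      Real.map_volume_mul_left (by norm_num), Measure.map_smul, map_add_left_eq_self]
    norm_num
  rw [← hpre, ← Measure.restrict_map (by fun_prop) measurableSet_Ioc, hmap, Measure.restrict_smul,
    ← add_smul, ← ENNReal.ofReal_add (by norm_num) (by norm_num)]
  norm_num

/-- Existence: if `F` is a continuous, strictly increasing CDF on `[0,1]` with
continuous density `f` such that `x·f(x)` is nondecreasing on the completely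
mixed interval `[I(p̲), I(p̄)]`, then there exists a probability measure on
`[0,1]³` with all three marginals equal to the measure with CDF `F` that is
concentrated on the set `M` of potential matches. -/
theorem stmt10
    (F I f : ℝ → ℝ)
    (hF0 : F 0 = 0) (hF1 : F 1 = 1)
    (hFcont : ContinuousOn F (Set.Icc 0 1))
    (hFmono : StrictMonoOn F (Set.Icc 0 1))
    (hQ : ∀ p ∈ Set.Icc (0:ℝ) 1, I p ∈ Set.Icc (0:ℝ) 1 ∧ F (I p) = p)
    (hfcont : ContinuousOn f (Set.Icc 0 1))
    (hfderiv : ∀ x ∈ Set.Icc (0:ℝ) 1, HasDerivWithinAt F (f x) (Set.Icc 0 1) x)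
    (p₀ : ℝ) (hp₀ : p₀ ∈ Set.Ioc (0:ℝ) (1/3))
    (hp₀eq : (1/3 - p₀) * Real.log (I p₀ * (I (1 - 2*p₀))^2)
      = ∫ p in p₀..(1 - 2*p₀), Real.log (I p))
    (pbar C : ℝ) (hpbar : pbar = 1 - 2*p₀) (hC : C = I p₀ * (I pbar)^2)
    (hxf : MonotoneOn (fun x => x * f x) (Set.Icc (I p₀) (I pbar)))
    (M : Set (ℝ × ℝ × ℝ))
    (hM : M = (fun p => (I p, I (1 - 2*p), I (1 - 2*p))) '' Set.Ico 0 p₀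
        ∪ (fun p => (I (1 - 2*p), I p, I (1 - 2*p))) '' Set.Ico 0 p₀
        ∪ (fun p => (I (1 - 2*p), I (1 - 2*p), I p)) '' Set.Ico 0 p₀
        ∪ {q : ℝ × ℝ × ℝ | q.1 ∈ Set.Icc (I p₀) (I pbar)
            ∧ q.2.1 ∈ Set.Icc (I p₀) (I pbar) ∧ q.2.2 ∈ Set.Icc (I p₀) (I pbar)
            ∧ q.1 * q.2.1 * q.2.2 = C})
    (μ : Measure ℝ) [IsProbabilityMeasure μ]
    (hμ : ∀ x ∈ Set.Icc (0:ℝ) 1, μ (Set.Iic x) = ENNReal.ofReal (F x)) :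
    ∃ π : Measure (ℝ × ℝ × ℝ), IsProbabilityMeasure π
      ∧ π.map (fun q => q.1) = μ ∧ π.map (fun q => q.2.1) = μ
      ∧ π.map (fun q => q.2.2) = μ ∧ π M = 1 := by
  obtain ⟨hp0, hp1⟩ := hp₀
  have hp₀m : p₀ ∈ Icc (0 : ℝ) 1 := ⟨hp0.le, by linarith⟩
  have hpbm : pbar ∈ Icc (0 : ℝ) 1 := ⟨by linarith, by linarith⟩
  have hle : p₀ ≤ pbar := by linarith
  have hIF : ∀ x ∈ Icc (0 : ℝ) 1, F x ∈ Icc (0 : ℝ) 1 ∧ I (F x) = x := by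
    intro x hx
    have hFx : F x ∈ Icc (0 : ℝ) 1 :=
      ⟨hF0 ▸ hFmono.monotoneOn (by simp) hx hx.1, hF1 ▸ hFmono.monotoneOn hx (by simp) hx.2⟩
    exact ⟨hFx, hFmono.injOn (hQ _ hFx).1 hx (hQ _ hFx).2⟩
  have hImono : StrictMonoOn I (Icc 0 1) := fun p hp q hq hpq => by
    rw [← hFmono.lt_iff_lt (hQ p hp).1 (hQ q hq).1, (hQ p hp).2, (hQ q hq).2]
    exact hpq
  let J' : ℝ → Icc (0 : ℝ) 1 := fun p =>
    ⟨I (projIcc 0 1 zero_le_one p), (hQ _ (projIcc 0 1 zero_le_one p).2).1⟩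
  let J : ℝ → ℝ := fun p => J' p
  have hJI : ∀ p ∈ Icc (0 : ℝ) 1, J p = I p := fun p hp => by
    simp only [J, J', projIcc_of_mem zero_le_one hp]
  have hJ'c : Continuous J' := by
    refine Monotone.continuous_of_surjective (fun p q hpq => ?_) fun x => ?_
    · exact hImono.monotoneOn (projIcc 0 1 zero_le_one p).2 (projIcc 0 1 zero_le_one q).2
        (monotone_projIcc zero_le_one hpq)
    · obtain ⟨h1, h2⟩ := hIF x x.2
      exact ⟨F x, Subtype.ext ((hJI _ h1).trans h2)⟩
  have hJc : Continuous J := continuous_subtype_val.comp hJ'c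
  have hJm : Measurable J := hJc.measurable
  have hμJ : (volume.restrict (Icc (0 : ℝ) 1)).map J = μ :=
    map_quantile_eq hF1 hF0 hFmono hJm
      (fun p hp => by rw [hJI p hp]; exact hQ p hp) μ hμ
  have hIp := hQ _ hp₀m
  have hIb := hQ _ hpbm
  have ha : 0 < I p₀ := by
    rw [← hFmono.lt_iff_lt (by simp) hIp.1, hIp.2, hF0]
    exact hp0
  have hsubab : Icc (I p₀) (I pbar) ⊆ Icc 0 1 := Icc_subset_Icc hIp.1.1 hIb.1.2
  let K : Set (ℝ × ℝ × ℝ) := {q : ℝ × ℝ × ℝ | q.1 ∈ Icc (I p₀) (I pbar)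
    ∧ q.2.1 ∈ Icc (I p₀) (I pbar) ∧ q.2.2 ∈ Icc (I p₀) (I pbar) ∧ q.1 * q.2.1 * q.2.2 = C}
  have hKc : IsCompact K := by
    have h1 : IsCompact (Icc (I p₀) (I pbar) ×ˢ Icc (I p₀) (I pbar) ×ˢ Icc (I p₀) (I pbar)) :=
      isCompact_Icc.prod (isCompact_Icc.prod isCompact_Icc)
    have h2 : IsClosed {q : ℝ × ℝ × ℝ | q.1 * q.2.1 * q.2.2 = C} :=
      isClosed_eq (by fun_prop) continuous_const
    convert h1.inter_right h2 using 1
    ext q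
    simp only [K, mem_ofPred_eq, mem_inter_iff, mem_prod]
    tauto
  have hKrot : ∀ q ∈ K, (q.2.1, q.2.2, q.1) ∈ K := fun q ⟨h1, h2, h3, h4⟩ =>
    ⟨h2, h3, h1, by rw [← h4]; ring⟩
  let ν₀ : Measure ℝ := volume.restrict (Ico 0 p₀)
  let ν₁ : Measure ℝ := volume.restrict (Icc p₀ pbar)
  let ν₂ : Measure ℝ := volume.restrict (Ioc pbar 1)
  obtain ⟨σ, hσK, hσ1, hσ2, hσ3⟩ := exists_measure_marginals_eq hKc hKrot (ν₁.map J) (by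
    intro φ hφ
    rw [integral_map hJm.aemeasurable φ.continuous.aestronglyMeasurable,
      integral_Icc_eq_integral_Ioc, ← intervalIntegral.integral_of_le hle]
    rcases hle.eq_or_lt with heq | hlt
    · rw [← heq, intervalIntegral.integral_same]
    have hFp : p₀ = F (I p₀) := hIp.2.symm
    have hFb : pbar = F (I pbar) := hIb.2.symm
    have key := integral_comp_quantile_nonneg (F := F) (f := f) (J := J) (φ := φ) ha
      (hImono hp₀m hpbm hlt) hJc
      (fun x hx => by
        obtain ⟨h1, h2⟩ := hIF x (hsubab hx)
        rw [hJI _ h1, h2])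
      (fun x hx => (hfderiv x (hsubab hx)).mono hsubab) (hfcont.mono hsubab)
      (hFmono.monotoneOn.mono hsubab) hxf
      (by
        rw [hIp.2, hIb.2]
        have e : ∫ p in p₀..pbar, Real.log (J p) = ∫ p in p₀..pbar, Real.log (I p) := by
          refine intervalIntegral.integral_congr fun p hp => ?_
          rw [uIcc_of_le hle] at hp
          simp only [hJI p ⟨hp0.le.trans hp.1, hp.2.trans hpbm.2⟩]
        rw [e, hpbar, ← hp₀eq]
        ring)
      φ.continuous
      (fun x hx y hy z hz h => hφ (x, y, z) ⟨hx, hy, hz, by rw [hC]; exact h⟩)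
    rwa [hIp.2, hIb.2] at key)
  have hsplit : ν₀.map J + ν₁.map J + ν₂.map J = μ := by
    rw [← hμJ, ← Measure.map_add _ _ hJm, ← Measure.map_add _ _ hJm]
    congr 1
    have hd₁ : Disjoint (Ico 0 p₀) (Icc p₀ pbar) :=
      disjoint_left.2 fun p hp hp' => by linarith [hp.2, hp'.1]
    have hd₂ : Disjoint (Icc 0 pbar) (Ioc pbar 1) :=
      disjoint_left.2 fun p hp hp' => by linarith [hp.2, hp'.1]
    rw [← Measure.restrict_union hd₁ measurableSet_Icc, Ico_union_Icc_eq_Icc hp0.le hle,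
      ← Measure.restrict_union hd₂ measurableSet_Ioc, Icc_union_Ioc_eq_Icc hpbm.1 hpbm.2]
  have hJ2m : Measurable fun p => J (1 - 2 * p) := hJm.comp (by fun_prop)
  have htail : ν₀.map (fun p => J (1 - 2 * p)) + ν₀.map (fun p => J (1 - 2 * p)) = ν₂.map J := by
    have h := congrArg (Measure.map J) (two_smul_map_one_sub_two_mul p₀)
    rw [Measure.map_add _ _ hJm, Measure.map_map hJm (by fun_prop), ← hpbar] at h
    exact h
  let g₁ : ℝ → ℝ × ℝ × ℝ := fun p => (J p, J (1 - 2 * p), J (1 - 2 * p))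
  let g₂ : ℝ → ℝ × ℝ × ℝ := fun p => (J (1 - 2 * p), J p, J (1 - 2 * p))
  let g₃ : ℝ → ℝ × ℝ × ℝ := fun p => (J (1 - 2 * p), J (1 - 2 * p), J p)
  have hg₁ : Measurable g₁ := hJm.prodMk (hJ2m.prodMk hJ2m)
  have hg₂ : Measurable g₂ := hJ2m.prodMk (hJm.prodMk hJ2m)
  have hg₃ : Measurable g₃ := hJ2m.prodMk (hJ2m.prodMk hJm)
  have hmap1 : (σ + ν₀.map g₁ + ν₀.map g₂ + ν₀.map g₃).map (fun q => q.1) = μ := by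
    rw [Measure.map_add _ _ (by fun_prop), Measure.map_add _ _ (by fun_prop),
      Measure.map_add _ _ (by fun_prop), Measure.map_map (by fun_prop) hg₁,
      Measure.map_map (by fun_prop) hg₂, Measure.map_map (by fun_prop) hg₃, hσ1, ← hsplit, ← htail]
    simp only [g₁, g₂, g₃, Function.comp_def]
    abel
  have hprob : IsProbabilityMeasure (σ + ν₀.map g₁ + ν₀.map g₂ + ν₀.map g₃) := by
    refine ⟨?_⟩
    have h := congrArg (fun τ : Measure ℝ => τ univ) hmap1
    simp only [measure_univ] at h
    rwa [Measure.map_apply (by fun_prop) MeasurableSet.univ, preimage_univ] at h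
  refine ⟨σ + ν₀.map g₁ + ν₀.map g₂ + ν₀.map g₃, hprob, hmap1, ?_, ?_, ?_⟩
  · rw [Measure.map_add _ _ (by fun_prop), Measure.map_add _ _ (by fun_prop),
      Measure.map_add _ _ (by fun_prop), Measure.map_map (by fun_prop) hg₁,
      Measure.map_map (by fun_prop) hg₂, Measure.map_map (by fun_prop) hg₃, hσ2, ← hsplit, ← htail]
    simp only [g₁, g₂, g₃, Function.comp_def]
    abel
  · rw [Measure.map_add _ _ (by fun_prop), Measure.map_add _ _ (by fun_prop),
      Measure.map_add _ _ (by fun_prop), Measure.map_map (by fun_prop) hg₁,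
      Measure.map_map (by fun_prop) hg₂, Measure.map_map (by fun_prop) hg₃, hσ3, ← hsplit, ← htail]
    simp only [g₁, g₂, g₃, Function.comp_def]
    abel
  · have hJmem : ∀ p ∈ Ico 0 p₀, J p = I p ∧ J (1 - 2 * p) = I (1 - 2 * p) := fun p hp =>
      ⟨hJI p ⟨hp.1, by linarith [hp.2]⟩, hJI _ ⟨by linarith [hp.2], by linarith [hp.1]⟩⟩
    have hJinj : InjOn J (Ico 0 p₀) := fun p hp q hq hpq =>
      hImono.injOn ⟨hp.1, by linarith [hp.2]⟩ ⟨hq.1, by linarith [hq.2]⟩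
        (by rw [← (hJmem p hp).1, ← (hJmem q hq).1, hpq])
    have hM' : M = g₁ '' Ico 0 p₀ ∪ g₂ '' Ico 0 p₀ ∪ g₃ '' Ico 0 p₀ ∪ K := by
      rw [hM]
      congr 1
      congr 1
      congr 1
      all_goals
        refine image_congr fun p hp => ?_
        simp only [g₁, g₂, g₃, (hJmem p hp).1, (hJmem p hp).2]
    have hm₁ : MeasurableSet (g₁ '' Ico 0 p₀) := measurableSet_Ico.image_of_measurable_injOn hg₁
      fun p hp q hq hpq => hJinj hp hq (congrArg (fun v => v.1) hpq)
    have hm₂ : MeasurableSet (g₂ '' Ico 0 p₀) := measurableSet_Ico.image_of_measurable_injOn hg₂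
      fun p hp q hq hpq => hJinj hp hq (congrArg (fun v => v.2.1) hpq)
    have hm₃ : MeasurableSet (g₃ '' Ico 0 p₀) := measurableSet_Ico.image_of_measurable_injOn hg₃
      fun p hp q hq hpq => hJinj hp hq (congrArg (fun v => v.2.2) hpq)
    have hMm : MeasurableSet M := hM' ▸ ((hm₁.union hm₂).union hm₃).union hKc.measurableSet
    have hnull : ∀ g : ℝ → ℝ × ℝ × ℝ, Measurable g → g '' Ico 0 p₀ ⊆ M →
        ν₀.map g Mᶜ = 0 := by
      intro g hg hgM
      rw [Measure.map_apply hg hMm.compl, Measure.restrict_apply (hg hMm.compl)]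
      convert measure_empty (μ := volume (α := ℝ))
      ext p
      simp only [mem_inter_iff, mem_preimage, mem_compl_iff, mem_empty_iff_false, iff_false,
        not_and]
      exact fun h hp => h (hgM (mem_image_of_mem g hp))
    have hσM : σ Mᶜ = 0 :=
      measure_mono_null (compl_subset_compl.2 (hM' ▸ subset_union_right)) hσK
    have hs₁ : g₁ '' Ico 0 p₀ ⊆ M := fun q hq => hM' ▸ Or.inl (Or.inl (Or.inl hq))
    have hs₂ : g₂ '' Ico 0 p₀ ⊆ M := fun q hq => hM' ▸ Or.inl (Or.inl (Or.inr hq))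
    have hs₃ : g₃ '' Ico 0 p₀ ⊆ M := fun q hq => hM' ▸ Or.inl (Or.inr hq)
    rw [← prob_compl_eq_zero_iff hMm]
    simp [hσM, hnull g₁ hg₁ hs₁, hnull g₂ hg₂ hs₂, hnull g₃ hg₃ hs₃]
end

section
/- Let F_x and F_z be Borel probability measures on [0,1] and let y(x₁,x₂,z) = z(1 − x₁·x₂) on [0,1]³. Consider the dual problem of minimizing ∫ w₁ dF_x + ∫ w₂ dF_x + ∫ v dF_z over integrable functions w₁, w₂, v : [0,1] → ℝ subject to w₁(x₁) + w₂(x₂) + v(z) ≥ y(x₁,x₂,z) for all (x₁,x₂,z) ∈ [0,1]³. If (w₁, w₂, v) is a solution of this dual problem, then there exist Lipschitz continuous functions ŵ₁, ŵ₂, v̂ : [0,1] → ℝ that are feasible for the same constraint, attain the same (minimal) value of the objective, and satisfy ŵ₁ = w₁ F_x-almost everywhere, ŵ₂ = w₂ F_x-almost everywhere, and v̂ = v F_z-almost everywhere. -/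
open MeasureTheory Set

/-- The smallest `W` with `c x i ≤ W x + b i` is Lipschitz if every `c · i` is, with a common
constant; it agrees almost everywhere with any integral-minimizing competitor `w`. -/
lemma exists_lipschitzWith_feasible_ae_eq {ι : Type*} [Nonempty ι] {μ : Measure ℝ}
    [IsProbabilityMeasure μ] (hμ : μ (Icc 0 1) = 1) (K : NNReal) (c : ℝ → ι → ℝ)
    (hc : ∀ i, LipschitzWith K fun x => c x i) (b : ι → ℝ) (w : ℝ → ℝ) (hw : Integrable w μ)
    (hfeas : ∀ x ∈ Icc (0 : ℝ) 1, ∀ i, c x i ≤ w x + b i)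
    (hopt : ∀ w' : ℝ → ℝ, Integrable w' μ →
      (∀ x ∈ Icc (0 : ℝ) 1, ∀ i, c x i ≤ w' x + b i) → ∫ x, w x ∂μ ≤ ∫ x, w' x ∂μ) :
    ∃ W : ℝ → ℝ, LipschitzWith K W ∧ (∀ x ∈ Icc (0 : ℝ) 1, ∀ i, c x i ≤ W x + b i) ∧
      W =ᵐ[μ] w := by
  have hle : ∀ i x x', c x i ≤ c x' i + K * dist x x' := fun i =>
    LipschitzWith.iff_le_add_mul.1 (hc i)
  have hbdd : ∀ x, BddAbove (range fun i => c x i - b i) := by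
    intro x
    refine ⟨w 0 + K * dist x 0, ?_⟩
    rintro _ ⟨i, rfl⟩
    have h₁ := hle i x 0
    have h₂ := hfeas 0 (by simp) i
    dsimp only
    linarith
  set W : ℝ → ℝ := fun x => ⨆ i, (c x i - b i)
  have hlip : LipschitzWith K W := by
    refine LipschitzWith.of_le_add_mul K fun x x' => ciSup_le fun i => ?_
    have h₁ := hle i x x'
    have h₂ : c x' i - b i ≤ W x' := le_ciSup (hbdd x') i
    linarith
  have hWfeas : ∀ x ∈ Icc (0 : ℝ) 1, ∀ i, c x i ≤ W x + b i := by
    intro x _ i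
    have h : c x i - b i ≤ W x := le_ciSup (hbdd x) i
    linarith
  have hIcc : ∀ᵐ x ∂μ, x ∈ Icc (0 : ℝ) 1 := (prob_compl_eq_zero_iff measurableSet_Icc).2 hμ
  have hWw : W ≤ᵐ[μ] w := by
    filter_upwards [hIcc] with x hx
    refine ciSup_le fun i => ?_
    have h := hfeas x hx i
    linarith
  have hint : Integrable W μ := by
    refine Integrable.of_bound hlip.continuous.aestronglyMeasurable (|W 0| + K) ?_
    filter_upwards [hIcc] with x hx
    have h := hlip.dist_le_mul x 0
    rw [Real.dist_eq, Real.dist_eq, sub_zero, abs_of_nonneg hx.1] at h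
    have h₁ : (K : ℝ) * x ≤ K := mul_le_of_le_one_right K.2 hx.2
    have h₂ := abs_sub_abs_le_abs_sub (W x) (W 0)
    rw [Real.norm_eq_abs]
    linarith
  refine ⟨W, hlip, hWfeas, ?_⟩
  exact (integral_eq_iff_of_ae_le hint hw hWw).1
    (le_antisymm (integral_mono_ae hint hw hWw) (hopt W hint hWfeas))

/-- An affine function whose slope is at most one in absolute value is `1`-Lipschitz. -/
lemma lipschitzWith_one_of_affine (f : ℝ → ℝ) (m : ℝ) (hm : |m| ≤ 1)
    (hf : ∀ x x', f x - f x' = m * (x - x')) : LipschitzWith 1 f := by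
  refine LipschitzWith.of_dist_le_mul fun x x' => ?_
  rw [Real.dist_eq, Real.dist_eq, hf, abs_mul, NNReal.coe_one]
  exact mul_le_mul_of_nonneg_right hm (abs_nonneg _)

/-- Regularity of dual solutions: any solution `(w₁, w₂, v)` of the dual
problem for the output `y(x₁,x₂,z) = z(1 − x₁·x₂)` agrees almost everywhere
with a triple of Lipschitz continuous functions that is feasible and attains
the same (minimal) dual value. -/
theorem stmt16
    (Fx Fz : Measure ℝ) [IsProbabilityMeasure Fx] [IsProbabilityMeasure Fz]
    (hFx : Fx (Set.Icc 0 1) = 1) (hFz : Fz (Set.Icc 0 1) = 1)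
    (y : ℝ × ℝ × ℝ → ℝ) (hy : ∀ q, y q = q.2.2 * (1 - q.1 * q.2.1))
    (w₁ w₂ v : ℝ → ℝ)
    (hw₁ : Integrable w₁ Fx) (hw₂ : Integrable w₂ Fx) (hv : Integrable v Fz)
    (hfeas : ∀ q ∈ Set.Icc (0:ℝ) 1 ×ˢ Set.Icc (0:ℝ) 1 ×ˢ Set.Icc (0:ℝ) 1,
      y q ≤ w₁ q.1 + w₂ q.2.1 + v q.2.2)
    (hopt : ∀ w₁' w₂' v' : ℝ → ℝ, Integrable w₁' Fx → Integrable w₂' Fx →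
      Integrable v' Fz →
      (∀ q ∈ Set.Icc (0:ℝ) 1 ×ˢ Set.Icc (0:ℝ) 1 ×ˢ Set.Icc (0:ℝ) 1,
        y q ≤ w₁' q.1 + w₂' q.2.1 + v' q.2.2) →
      ∫ x, w₁ x ∂Fx + ∫ x, w₂ x ∂Fx + ∫ z, v z ∂Fz
        ≤ ∫ x, w₁' x ∂Fx + ∫ x, w₂' x ∂Fx + ∫ z, v' z ∂Fz) :
    ∃ (W₁ W₂ V : ℝ → ℝ) (K₁ K₂ K₃ : NNReal),
      LipschitzWith K₁ W₁ ∧ LipschitzWith K₂ W₂ ∧ LipschitzWith K₃ V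
      ∧ (∀ q ∈ Set.Icc (0:ℝ) 1 ×ˢ Set.Icc (0:ℝ) 1 ×ˢ Set.Icc (0:ℝ) 1,
          y q ≤ W₁ q.1 + W₂ q.2.1 + V q.2.2)
      ∧ (∫ x, W₁ x ∂Fx + ∫ x, W₂ x ∂Fx + ∫ z, V z ∂Fz
          = ∫ x, w₁ x ∂Fx + ∫ x, w₂ x ∂Fx + ∫ z, v z ∂Fz)
      ∧ W₁ =ᵐ[Fx] w₁ ∧ W₂ =ᵐ[Fx] w₂ ∧ V =ᵐ[Fz] v := by
  obtain rfl : y = fun q => q.2.2 * (1 - q.1 * q.2.1) := funext hy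
  have hprod : ∀ a b : Icc (0 : ℝ) 1, 0 ≤ (a * b : ℝ) ∧ (a * b : ℝ) ≤ 1 := fun a b =>
    ⟨mul_nonneg a.2.1 b.2.1, mul_le_one₀ a.2.2 b.2.1 b.2.2⟩
  obtain ⟨W₁, hL₁, hf₁, he₁⟩ := exists_lipschitzWith_feasible_ae_eq
    (ι := Icc (0 : ℝ) 1 × Icc (0 : ℝ) 1) hFx 1 (fun x p => (p.2 : ℝ) * (1 - x * p.1))
    (fun p => lipschitzWith_one_of_affine _ (-(p.1 * p.2))
      (by rw [abs_neg, abs_le]; constructor <;> linarith [hprod p.1 p.2]) (by intros; ring))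
    (fun p => w₂ p.1 + v p.2) w₁ hw₁
    (fun x hx p => by linarith [hfeas (x, p.1, p.2) ⟨hx, p.1.2, p.2.2⟩])
    (fun w' hw' h => by
      linarith [hopt w' w₂ v hw' hw₂ hv fun q hq => by
        linarith [h q.1 hq.1 (⟨q.2.1, hq.2.1⟩, ⟨q.2.2, hq.2.2⟩)]])
  have hi₁ := hw₁.congr he₁.symm
  obtain ⟨W₂, hL₂, hf₂, he₂⟩ := exists_lipschitzWith_feasible_ae_eq
    (ι := Icc (0 : ℝ) 1 × Icc (0 : ℝ) 1) hFx 1 (fun x p => (p.2 : ℝ) * (1 - p.1 * x))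
    (fun p => lipschitzWith_one_of_affine _ (-(p.1 * p.2))
      (by rw [abs_neg, abs_le]; constructor <;> linarith [hprod p.1 p.2]) (by intros; ring))
    (fun p => W₁ p.1 + v p.2) w₂ hw₂
    (fun x hx p => by linarith [hf₁ p.1 p.1.2 (⟨x, hx⟩, p.2)])
    (fun w' hw' h => by
      linarith [integral_congr_ae he₁, hopt W₁ w' v hi₁ hw' hv fun q hq => by
        linarith [h q.2.1 hq.2.1 (⟨q.1, hq.1⟩, ⟨q.2.2, hq.2.2⟩)]])
  have hi₂ := hw₂.congr he₂.symm
  obtain ⟨V, hL₃, hf₃, he₃⟩ := exists_lipschitzWith_feasible_ae_eq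
    (ι := Icc (0 : ℝ) 1 × Icc (0 : ℝ) 1) hFz 1 (fun z p => z * (1 - p.1 * p.2))
    (fun p => lipschitzWith_one_of_affine _ (1 - p.1 * p.2)
      (by rw [abs_le]; constructor <;> linarith [hprod p.1 p.2]) (by intros; ring))
    (fun p => W₁ p.1 + W₂ p.2) v hv
    (fun z hz p => by linarith [hf₂ p.2 p.2.2 (p.1, ⟨z, hz⟩)])
    (fun v' hv' h => by
      linarith [integral_congr_ae he₁, integral_congr_ae he₂,
        hopt W₁ W₂ v' hi₁ hi₂ hv' fun q hq => by
          linarith [h q.2.2 hq.2.2 (⟨q.1, hq.1⟩, ⟨q.2.1, hq.2.1⟩)]])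
  refine ⟨W₁, W₂, V, 1, 1, 1, hL₁, hL₂, hL₃, fun q hq => ?_, ?_, he₁, he₂, he₃⟩
  · linarith [hf₃ q.2.2 hq.2.2 (⟨q.1, hq.1⟩, ⟨q.2.1, hq.2.1⟩)]
  · rw [integral_congr_ae he₁, integral_congr_ae he₂, integral_congr_ae he₃]
end

section
/- Let F be a cumulative distribution function on [0,1] that is strictly increasing and continuously differentiable with strictly positive density f = F′ on (0,1), and let I = F⁻¹ be its quantile function. Then x ↦ x·f(x) is nondecreasing on (0,1) if and only if p ↦ log I(p) is concave on (0,1). -/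
open Set Filter Topology in
/-- Derivative of the logarithm of a local left inverse of a continuously differentiable
function. -/
theorem hasDerivAt_log_of_leftInvOn {F I f : ℝ → ℝ} {s : Set ℝ} (hs : IsOpen s)
    (hfderiv : ∀ x ∈ s, HasDerivAt F (f x) x) (hfcont : ContinuousOn f s)
    (hleft : LeftInvOn I F s) {x : ℝ} (hx : x ∈ s) (hx0 : x ≠ 0) (hfx : f x ≠ 0) :
    HasDerivAt (fun p => Real.log (I p)) (x * f x)⁻¹ (F x) := by
  have hnhds : s ∈ 𝓝 x := hs.mem_nhds hx
  have hstrict : HasStrictDerivAt F (f x) x :=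
    hasStrictDerivAt_of_hasDerivAt_of_continuousAt
      (eventually_of_mem hnhds hfderiv) (hfcont.continuousAt hnhds)
  have hI : HasDerivAt I (f x)⁻¹ (F x) :=
    (hstrict.to_local_left_inverse hfx (eventually_of_mem hnhds hleft)).hasDerivAt
  have hIx : I (F x) = x := hleft hx
  convert hI.log (hIx.trans_ne hx0) using 1
  rw [hIx, mul_inv, div_eq_mul_inv, mul_comm]

/-- For a strictly increasing, continuously differentiable CDF `F` on `[0,1]`
with strictly positive density `f` on `(0,1)` and quantile function `I = F⁻¹`,
the map `x ↦ x·f(x)` is nondecreasing on `(0,1)` iff `p ↦ log I(p)` is concave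
on `(0,1)`. -/
theorem stmt17 (F I f : ℝ → ℝ)
    (hF0 : F 0 = 0) (hF1 : F 1 = 1)
    (hFmono : StrictMonoOn F (Set.Icc 0 1))
    (hfderiv : ∀ x ∈ Set.Ioo (0:ℝ) 1, HasDerivAt F (f x) x)
    (hfcont : ContinuousOn f (Set.Ioo 0 1))
    (hfpos : ∀ x ∈ Set.Ioo (0:ℝ) 1, 0 < f x)
    (hI : ∀ p ∈ Set.Ioo (0:ℝ) 1, I p ∈ Set.Ioo (0:ℝ) 1 ∧ F (I p) = p) :
    MonotoneOn (fun x => x * f x) (Set.Ioo 0 1)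
      ↔ ConcaveOn ℝ (Set.Ioo 0 1) (fun p => Real.log (I p)) := by
  have hmaps : Set.MapsTo F (Set.Ioo 0 1) (Set.Ioo 0 1) := by
    simpa only [hF0, hF1] using hFmono.mapsTo_Ioo
  have hFmono' : StrictMonoOn F (Set.Ioo 0 1) := hFmono.mono Set.Ioo_subset_Icc_self
  have hleft : Set.LeftInvOn I F (Set.Ioo 0 1) := fun x hx =>
    hFmono'.injOn (hI _ (hmaps hx)).1 hx (hI _ (hmaps hx)).2
  have hlog : ∀ x ∈ Set.Ioo (0:ℝ) 1,
      HasDerivAt (fun p => Real.log (I p)) (x * f x)⁻¹ (F x) := fun x hx =>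
    hasDerivAt_log_of_leftInvOn isOpen_Ioo hfderiv hfcont hleft hx hx.1.ne' (hfpos x hx).ne'
  have hlogI : ∀ p ∈ Set.Ioo (0:ℝ) 1,
      HasDerivAt (fun p => Real.log (I p)) (I p * f (I p))⁻¹ p := fun p hp => by
    simpa only [(hI p hp).2] using hlog _ (hI p hp).1
  have hpos : ∀ x ∈ Set.Ioo (0:ℝ) 1, 0 < x * f x := fun x hx => mul_pos hx.1 (hfpos x hx)
  constructor
  · intro hmono
    refine AntitoneOn.concaveOn_of_deriv (convex_Ioo 0 1)
      (fun p hp => (hlogI p hp).continuousAt.continuousWithinAt) ?_ ?_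
    · rw [interior_Ioo]
      exact fun p hp => (hlogI p hp).differentiableAt.differentiableWithinAt
    · rw [interior_Ioo]
      intro p hp q hq hpq
      rw [(hlogI p hp).deriv, (hlogI q hq).deriv]
      have hIpq : I p ≤ I q := by
        rwa [← hFmono'.le_iff_le (hI p hp).1 (hI q hq).1, (hI p hp).2, (hI q hq).2]
      exact inv_anti₀ (hpos _ (hI p hp).1) (hmono (hI p hp).1 (hI q hq).1 hIpq)
  · intro hconc x hx y hy hxy
    have hanti := hconc.antitoneOn_deriv
      (fun p hp => (hlogI p hp).differentiableAt)
      (hmaps hx) (hmaps hy) (hFmono'.monotoneOn hx hy hxy)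
    rw [(hlog x hx).deriv, (hlog y hy).deriv] at hanti
    exact (inv_le_inv₀ (hpos y hy) (hpos x hx)).1 hanti
end

section
/- Let F be a cumulative distribution function on [0,1] that is strictly increasing and continuously differentiable with strictly positive density f = F′ on (0,1), and let I = F⁻¹ be its quantile function. If x ↦ x·f(x) is nondecreasing on (0,1), then the logarithmic loss L(p) := 2·log I(1−2p) + log I(p) is concave on (0, 1/3). -/
/-- If `x * F' x` is nondecreasing on `(0, 1)`, then `F ∘ exp` is convex on `(-∞, 0)`. -/
theorem convexOn_comp_exp_of_monotoneOn_mul_deriv {F f : ℝ → ℝ}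
    (hF : ∀ x ∈ Set.Ioo (0 : ℝ) 1, HasDerivAt F (f x) x)
    (hf : MonotoneOn (fun x => x * f x) (Set.Ioo 0 1)) :
    ConvexOn ℝ (Set.Iio 0) (fun t => F (Real.exp t)) := by
  have mem : ∀ t ∈ Set.Iio (0 : ℝ), Real.exp t ∈ Set.Ioo (0 : ℝ) 1 := fun t ht =>
    ⟨Real.exp_pos t, Real.exp_lt_one_iff.2 ht⟩
  have hd : ∀ t ∈ Set.Iio (0 : ℝ),
      HasDerivAt (fun t => F (Real.exp t)) (f (Real.exp t) * Real.exp t) t := fun t ht =>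
    (hF _ (mem t ht)).comp t (Real.hasDerivAt_exp t)
  refine MonotoneOn.convexOn_of_deriv (convex_Iio 0)
    (fun t ht => (hd t ht).continuousAt.continuousWithinAt) ?_ ?_
  · rw [interior_Iio]
    exact fun t ht => (hd t ht).differentiableAt.differentiableWithinAt
  · rw [interior_Iio]
    intro s hs t ht hst
    rw [(hd s hs).deriv, (hd t ht).deriv, mul_comm, mul_comm (f (Real.exp t))]
    exact hf (mem s hs) (mem t ht) (Real.exp_le_exp.2 hst)

/-- A right inverse of a strictly increasing convex function is concave. -/
theorem ConvexOn.concaveOn_rightInvOn {G g : ℝ → ℝ} {s t : Set ℝ} (hG : ConvexOn ℝ s G)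
    (hmono : StrictMonoOn G s) (ht : Convex ℝ t) (hmaps : Set.MapsTo g t s)
    (hinv : Set.RightInvOn g G t) : ConcaveOn ℝ t g := by
  refine ⟨ht, fun p hp q hq a b ha hb hab => ?_⟩
  have hpq := ht hp hq ha hb hab
  rw [← hmono.le_iff_le (hG.1 (hmaps hp) (hmaps hq) ha hb hab) (hmaps hpq), hinv hpq]
  simpa only [hinv hp, hinv hq] using hG.2 (hmaps hp) (hmaps hq) ha hb hab


/-- For a strictly increasing, continuously differentiable CDF `F` on `[0,1]`
with strictly positive density `f` on `(0,1)` and quantile function `I = F⁻¹`: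
if `x ↦ x·f(x)` is nondecreasing on `(0,1)`, then the logarithmic loss
`L(p) = 2·log I(1−2p) + log I(p)` is concave on `(0, 1/3)`. -/
theorem stmt18 (F I f : ℝ → ℝ)
    (hF0 : F 0 = 0) (hF1 : F 1 = 1)
    (hFmono : StrictMonoOn F (Set.Icc 0 1))
    (hfderiv : ∀ x ∈ Set.Ioo (0:ℝ) 1, HasDerivAt F (f x) x)
    (hfcont : ContinuousOn f (Set.Ioo 0 1))
    (hfpos : ∀ x ∈ Set.Ioo (0:ℝ) 1, 0 < f x)
    (hI : ∀ p ∈ Set.Ioo (0:ℝ) 1, I p ∈ Set.Ioo (0:ℝ) 1 ∧ F (I p) = p)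
    (hxf : MonotoneOn (fun x => x * f x) (Set.Ioo 0 1)) :
    ConcaveOn ℝ (Set.Ioo 0 (1/3))
      (fun p => 2 * Real.log (I (1 - 2*p)) + Real.log (I p)) := by
  have hg : ConcaveOn ℝ (Set.Ioo 0 1) (fun p => Real.log (I p)) := by
    refine (convexOn_comp_exp_of_monotoneOn_mul_deriv hfderiv hxf).concaveOn_rightInvOn ?_
      (convex_Ioo 0 1) (fun p hp => Real.log_neg (hI p hp).1.1 (hI p hp).1.2) fun p hp => ?_
    · intro s hs t ht hst
      exact hFmono ⟨(Real.exp_pos s).le, (Real.exp_lt_one_iff.2 hs).le⟩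
        ⟨(Real.exp_pos t).le, (Real.exp_lt_one_iff.2 ht).le⟩ (Real.exp_lt_exp.2 hst)
    · simp only [Real.exp_log (hI p hp).1.1, (hI p hp).2]
  refine ⟨convex_Ioo _ _, fun p hp q hq a b ha hb hab => ?_⟩
  have h₁ := hg.2 (x := p) (y := q) ⟨hp.1, by linarith [hp.2]⟩ ⟨hq.1, by linarith [hq.2]⟩ ha hb hab
  have h₂ := hg.2 (x := 1 - 2 * p) (y := 1 - 2 * q) ⟨by linarith [hp.2], by linarith [hp.1]⟩
    ⟨by linarith [hq.2], by linarith [hq.1]⟩ ha hb hab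
  have h₃ : a * (1 - 2 * p) + b * (1 - 2 * q) = 1 - 2 * (a * p + b * q) := by
    linear_combination hab
  simp only [smul_eq_mul] at h₁ h₂ ⊢
  rw [h₃] at h₂
  linarith
end
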